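/- A vector (1,h1,h2,h3) ∈ ℤ^4 is the h-vector of a 2-dimensional connected Buchsbaum simplicial complex if and only if: (i) 0 ≤ h1; (ii) 0 ≤ h2 ≤ C(h1+1,2); and (iii) −(1/3)·h2 ≤ h3 ≤ h2^⟨2⟩. -/

import Mathlib

open Finset

noncomputable section

/-- `Δ` is a simplicial complex on `[n] = {1,…,n}`: a collection of subsets of `[n]`,
closed under taking subsets, containing every singleton `{i}` for `i ∈ [n]`. -/
def IsComplexOn (n : ℕ) (Δ : Finset (Finset ℕ)) : Prop :=
  (∀ F ∈ Δ, ∀ G ⊆ F, G ∈ Δ) ∧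
  (∀ F ∈ Δ, ∀ i ∈ F, i ∈ Finset.Icc 1 n) ∧
  (∀ i ∈ Finset.Icc 1 n, ({i} : Finset ℕ) ∈ Δ)

/-- a simplicial complex whose vertex set is contained in `[n]`:
a downward closed collection of subsets of `[n]`. -/
def IsComplexIn (n : ℕ) (Δ : Finset (Finset ℕ)) : Prop :=
  (∀ F ∈ Δ, ∀ G ⊆ F, G ∈ Δ) ∧ (∀ F ∈ Δ, ∀ i ∈ F, i ∈ Finset.Icc 1 n)

/-- the faces of `Δ` with `m` vertices -/
def facesOf (Δ : Finset (Finset ℕ)) (m : ℕ) : Finset (Finset ℕ) :=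
  Δ.filter fun F => F.card = m

/-- `fVec Δ j = f_{j-1}(Δ)`, the number of faces of `Δ` with `j` vertices;
by convention `f_{-1}(Δ) = 1`. -/
def fVec (Δ : Finset (Finset ℕ)) (j : ℕ) : ℤ :=
  if j = 0 then 1 else ((facesOf Δ j).card : ℤ)

/-- the `h`-vector of a `(d-1)`-dimensional complex, defined by
`∑ f_{i-1} (x-1)^{d-i} = ∑ h_i x^{d-i}`, i.e.
`h_i = ∑_{j=0}^{i} (-1)^{i-j} C(d-j, i-j) f_{j-1}`. -/
def hVec (d : ℕ) (Δ : Finset (Finset ℕ)) (i : ℕ) : ℤ :=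
  ∑ j ∈ Finset.range (i + 1),
    (-1 : ℤ) ^ (i - j) * ((d - j).choose (i - j) : ℤ) * fVec Δ j

/-- the dimension `max {k : f_k(Δ) ≠ 0}` of `Δ`, as an integer -/
def dimZ (Δ : Finset (Finset ℕ)) : ℤ := ((Δ.sup Finset.card : ℕ) : ℤ) - 1

/-- the link `lk_Δ(F) = {G : G ∩ F = ∅, G ∪ F ∈ Δ}` -/
def link (Δ : Finset (Finset ℕ)) (F : Finset ℕ) : Finset (Finset ℕ) :=
  Δ.filter fun G => Disjoint G F ∧ G ∪ F ∈ Δ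

variable (K : Type) [Field K]

/-- the simplicial boundary operator on formal `K`-linear combinations of
finite subsets of `ℕ` (vertices ordered by the order on `ℕ`):
`∂ F = ∑_{v ∈ F} (-1)^{#{u ∈ F : u < v}} (F \ {v})`. -/
def bdry : (Finset ℕ →₀ K) →ₗ[K] (Finset ℕ →₀ K) :=
  Finsupp.lsum K fun F => LinearMap.toSpanSingleton K (Finset ℕ →₀ K)
    (∑ v ∈ F, ((-1 : K) ^ ((F.filter fun u => u < v).card)) • Finsupp.single (F.erase v) (1 : K))

/-- the space of simplicial `K`-chains of `Δ` spanned by the faces with `m` vertices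
(for `m = 0` this is the span of the empty face, giving *reduced* homology) -/
def chains (Δ : Finset (Finset ℕ)) (m : ℕ) : Submodule K (Finset ℕ →₀ K) :=
  Submodule.span K ((fun F => Finsupp.single F (1 : K)) '' (facesOf Δ m : Set (Finset ℕ)))

/-- the dimension of the reduced homology of `Δ` at faces of cardinality `m`:
`dim (ker ∂ ∩ C_m) - dim (∂ C_{m+1})` -/
def homDim (Δ : Finset (Finset ℕ)) (m : ℕ) : ℕ :=
  Module.finrank K ↥(chains K Δ m ⊓ LinearMap.ker (bdry K))
    - Module.finrank K ↥((chains K Δ (m + 1)).map (bdry K))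

/-- the reduced Betti number `β_i(Δ; K) = dim_K H̃_i(Δ; K)` for `i : ℤ` -/
def betti (Δ : Finset (Finset ℕ)) (i : ℤ) : ℕ :=
  if 0 ≤ i + 1 then homDim K Δ (i + 1).toNat else 0

/-- all facets (maximal faces) of `Δ` have the same cardinality -/
def IsPure (Δ : Finset (Finset ℕ)) : Prop :=
  ∀ F ∈ Δ, (∀ G ∈ Δ, F ⊆ G → F = G) → F.card = Δ.sup Finset.card

/-- `Δ` is Cohen–Macaulay (over `K`): for every face `F ∈ Δ` (including `∅`),
`β_i(lk_Δ(F)) = 0` for all `i ≠ dim Δ - |F|`. -/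
def IsCohenMacaulay (Δ : Finset (Finset ℕ)) : Prop :=
  ∀ F ∈ Δ, ∀ i : ℤ, i ≠ dimZ Δ - F.card → betti K (link Δ F) i = 0

/-- `Δ` is Buchsbaum (over `K`): `Δ` is pure and the link of every vertex is
Cohen–Macaulay. -/
def IsBuchsbaum (Δ : Finset (Finset ℕ)) : Prop :=
  IsPure Δ ∧ ∀ v : ℕ, ({v} : Finset ℕ) ∈ Δ → IsCohenMacaulay K (link Δ {v})

/-- `Δ` is connected: any two vertices are joined by a path of edges of `Δ` -/
def IsConnectedComplex (Δ : Finset (Finset ℕ)) : Prop :=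
  ∀ u v : ℕ, ({u} : Finset ℕ) ∈ Δ → ({v} : Finset ℕ) ∈ Δ →
    Relation.ReflTransGen (fun a b : ℕ => a ≠ b ∧ ({a, b} : Finset ℕ) ∈ Δ) u v

/-- `Δ` is link-acyclic: `β_i(lk_Δ(v)) = 0` for every vertex `v` of `Δ` and every `i` -/
def IsLinkAcyclic (Δ : Finset (Finset ℕ)) : Prop :=
  ∀ v : ℕ, ({v} : Finset ℕ) ∈ Δ → ∀ i : ℤ, betti K (link Δ {v}) i = 0

/-- `Δ` is `2`-dimensional with `h`-vector `(a, b, c, e)` -/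
def hVector3 (Δ : Finset (Finset ℕ)) (a b c e : ℤ) : Prop :=
  hVec 3 Δ 0 = a ∧ hVec 3 Δ 1 = b ∧ hVec 3 Δ 2 = c ∧ hVec 3 Δ 3 = e

/-- `macaulay2 a = a^⟨2⟩`: if `a = C(b,2) + r` is the (greedy) `2`-nd Macaulay
representation (`b` maximal with `C(b,2) ≤ a`, `0 ≤ r < b`, `r = C(r,1)`), then
`a^⟨2⟩ = C(b+1,3) + C(r+1,2)`, and `0^⟨2⟩ = 0`. -/
def macaulay2 (a : ℕ) : ℕ :=
  if a = 0 then 0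
  else
    (Nat.findGreatest (fun t => t.choose 2 ≤ a) (a + 2) + 1).choose 3
      + (a - (Nat.findGreatest (fun t => t.choose 2 ≤ a) (a + 2)).choose 2 + 1).choose 2

/-- `modRep n i = ī`, the unique element of `[n] = {1,…,n}` congruent to `i` mod `n` -/
def modRep (n : ℕ) (i : ℤ) : ℕ := ((i - 1) % (n : ℤ)).toNat + 1


end


/-! ### Homology in low degrees -/

section Homology

variable (K : Type) [Field K]

theorem bdry_single (F : Finset ℕ) :
    bdry K (Finsupp.single F 1) = ∑ v ∈ F, ((-1 : K) ^ ((F.filter fun u => u < v).card)) •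
      Finsupp.single (F.erase v) (1 : K) := by
  simp [bdry]

theorem bdry_vertex (v : ℕ) :
    bdry K (Finsupp.single {v} 1) = Finsupp.single ∅ (1 : K) := by
  simp [bdry_single, Finset.filter_singleton]

theorem bdry_edge {a b : ℕ} (h : a < b) :
    bdry K (Finsupp.single {a, b} 1) = Finsupp.single {b} (1 : K) - Finsupp.single {a} 1 := by
  have h1 : ({a, b} : Finset ℕ).filter (fun u => u < a) = ∅ := by
    ext x; simp; omega
  have h2 : ({a, b} : Finset ℕ).filter (fun u => u < b) = {a} := by
    ext x; simp; omega
  have h3 : ({a, b} : Finset ℕ).erase a = {b} := by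
    ext x; simp; omega
  have h4 : ({a, b} : Finset ℕ).erase b = {a} := by
    ext x; simp; omega
  rw [bdry_single, Finset.sum_pair h.ne, h1, h2, h3, h4]
  simp [sub_eq_add_neg]

theorem chains_eq_bot {Δ : Finset (Finset ℕ)} {m : ℕ} (h : ∀ F ∈ Δ, F.card ≠ m) :
    chains K Δ m = ⊥ := by
  have : facesOf Δ m = ∅ := by
    simpa [facesOf, Finset.filter_eq_empty_iff] using h
  simp [chains, this]

instance finiteDimensional_chains (Δ : Finset (Finset ℕ)) (m : ℕ) :
    FiniteDimensional K (chains K Δ m) := by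
  unfold chains
  exact FiniteDimensional.span_of_finite K ((facesOf Δ m).finite_toSet.image _)

theorem single_mem_chains {Δ : Finset (Finset ℕ)} {F : Finset ℕ} {m : ℕ}
    (h : F ∈ Δ) (hF : F.card = m) : Finsupp.single F (1 : K) ∈ chains K Δ m :=
  Submodule.subset_span ⟨F, by simp [facesOf, h, hF], rfl⟩

theorem homDim_eq_zero_of_le {Δ : Finset (Finset ℕ)} {m : ℕ}
    (h : chains K Δ m ⊓ LinearMap.ker (bdry K) ≤ (chains K Δ (m + 1)).map (bdry K)) :
    homDim K Δ m = 0 :=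
  Nat.sub_eq_zero_of_le (Submodule.finrank_mono h)

theorem homDim_eq_zero_of_forall_card_ne {Δ : Finset (Finset ℕ)} {m : ℕ}
    (h : ∀ F ∈ Δ, F.card ≠ m) : homDim K Δ m = 0 := by
  apply homDim_eq_zero_of_le
  simp [chains_eq_bot K h]

theorem homDim_zero_eq_zero {Δ : Finset (Finset ℕ)} {v : ℕ} (h : {v} ∈ Δ) :
    homDim K Δ 0 = 0 := by
  apply homDim_eq_zero_of_le
  refine inf_le_left.trans (Submodule.span_le.2 ?_)
  rintro _ ⟨F, hF, rfl⟩
  have hF' : F = ∅ := by simpa [facesOf] using (Finset.mem_filter.1 hF).2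
  subst hF'
  exact ⟨_, single_mem_chains K h (Finset.card_singleton v), bdry_vertex K v⟩

theorem single_sub_single_mem_map {Δ : Finset (Finset ℕ)} {a b : ℕ}
    (h : a ≠ b ∧ {a, b} ∈ Δ) :
    Finsupp.single {b} (1 : K) - Finsupp.single {a} 1 ∈ (chains K Δ 2).map (bdry K) := by
  obtain ⟨hne, h⟩ := h
  have key := single_mem_chains K h (Finset.card_pair hne)
  rcases lt_or_gt_of_ne hne with hlt | hlt
  · exact ⟨_, key, bdry_edge K hlt⟩
  · rw [← neg_sub]
    refine Submodule.neg_mem _ ⟨_, key, ?_⟩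
    rw [Finset.pair_comm, bdry_edge K hlt]

theorem single_sub_single_mem_map_of_path {Δ : Finset (Finset ℕ)} {a b : ℕ}
    (h : Relation.ReflTransGen (fun a b : ℕ => a ≠ b ∧ ({a, b} : Finset ℕ) ∈ Δ) a b) :
    Finsupp.single {b} (1 : K) - Finsupp.single {a} 1 ∈ (chains K Δ 2).map (bdry K) := by
  induction h with
  | refl => simp
  | tail _ h ih =>
    have := Submodule.add_mem _ ih (single_sub_single_mem_map K h)
    rwa [sub_add_sub_cancel'] at this

theorem homDim_one_eq_zero {Δ : Finset (Finset ℕ)} (h : IsConnectedComplex Δ) :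
    homDim K Δ 1 = 0 := by
  by_cases hv : ∃ v : ℕ, {v} ∈ Δ
  swap
  · apply homDim_eq_zero_of_forall_card_ne
    intro F hF h1
    obtain ⟨v, rfl⟩ := Finset.card_eq_one.1 h1
    exact hv ⟨v, hF⟩
  obtain ⟨v, hv⟩ := hv
  apply homDim_eq_zero_of_le
  set D := Submodule.span K ((fun u : ℕ => Finsupp.single ({u} : Finset ℕ) (1 : K) -
    Finsupp.single {v} 1) '' {u | {u} ∈ Δ}) with hD
  have hDmap : D ≤ (chains K Δ 2).map (bdry K) := by
    refine Submodule.span_le.2 ?_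
    rintro _ ⟨u, hu, rfl⟩
    exact single_sub_single_mem_map_of_path K (h v u hv hu)
  have hDker : D ≤ LinearMap.ker (bdry K) := by
    refine Submodule.span_le.2 ?_
    rintro _ ⟨u, hu, rfl⟩
    simp [bdry_vertex]
  have hsup : chains K Δ 1 ≤ D ⊔ Submodule.span K {Finsupp.single {v} 1} := by
    refine Submodule.span_le.2 ?_
    rintro _ ⟨F, hF, rfl⟩
    obtain ⟨hF, h1⟩ := Finset.mem_filter.1 hF
    obtain ⟨u, rfl⟩ := Finset.card_eq_one.1 h1
    refine Submodule.mem_sup.2 ⟨_, Submodule.subset_span ⟨u, hF, rfl⟩, _,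
      Submodule.mem_span_singleton_self _, ?_⟩
    simp
  rintro z ⟨hz, hzk⟩
  obtain ⟨y, hy, s, hs, rfl⟩ := Submodule.mem_sup.1 (hsup hz)
  obtain ⟨c, rfl⟩ := Submodule.mem_span_singleton.1 hs
  have hc : c = 0 := by
    have h1 : bdry K y = 0 := hDker hy
    have h2 : bdry K (y + c • Finsupp.single {v} 1) = 0 := hzk
    rw [map_add, h1, map_smul, bdry_vertex] at h2
    simpa using h2
  subst hc
  simpa using hDmap hy

theorem isConnectedComplex_of_homDim {Δ : Finset (Finset ℕ)}
    (hΔ : ∀ F ∈ Δ, ∀ G ⊆ F, G ∈ Δ) (h : homDim K Δ 1 = 0) :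
    IsConnectedComplex Δ := by
  classical
  intro u v hu hv
  by_contra hcon
  set R := Relation.ReflTransGen (fun a b : ℕ => a ≠ b ∧ ({a, b} : Finset ℕ) ∈ Δ) with hR
  let φ : (Finset ℕ →₀ K) →ₗ[K] K := Finsupp.lsum K fun F =>
    LinearMap.toSpanSingleton K K (if ∃ a, F = {a} ∧ R u a then 1 else 0)
  have hφ (a : ℕ) : φ (Finsupp.single {a} 1) = if R u a then 1 else 0 := by
    simp [φ]
  have hedge {a b : ℕ} (hab : a < b) (hE : ({a, b} : Finset ℕ) ∈ Δ) : R u a ↔ R u b :=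
    ⟨fun h => h.tail ⟨hab.ne, hE⟩, fun h => h.tail ⟨hab.ne', by rwa [Finset.pair_comm]⟩⟩
  have hbdry : ∀ F ∈ facesOf Δ 2, ∃ a b, {a} ∈ Δ ∧ {b} ∈ Δ ∧ (R u a ↔ R u b) ∧
      bdry K (Finsupp.single F 1) = Finsupp.single {b} (1 : K) - Finsupp.single {a} 1 := by
    intro F hF
    obtain ⟨hF, h2⟩ := Finset.mem_filter.1 hF
    obtain ⟨a, b, hne, rfl⟩ := Finset.card_eq_two.1 h2
    have ha : {a} ∈ Δ := hΔ _ hF _ (by simp)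
    have hb : {b} ∈ Δ := hΔ _ hF _ (by simp)
    rcases lt_or_gt_of_ne hne with hlt | hlt
    · exact ⟨a, b, ha, hb, hedge hlt hF, bdry_edge K hlt⟩
    · rw [Finset.pair_comm] at hF ⊢
      exact ⟨b, a, hb, ha, hedge hlt hF, bdry_edge K hlt⟩
  have hvert {a : ℕ} (ha : {a} ∈ Δ) : Finsupp.single {a} (1 : K) ∈ chains K Δ 1 :=
    single_mem_chains K ha (Finset.card_singleton a)
  have hle : (chains K Δ 2).map (bdry K) ≤ chains K Δ 1 ⊓ LinearMap.ker (bdry K) := by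
    rw [Submodule.map_le_iff_le_comap]
    refine Submodule.span_le.2 ?_
    rintro _ ⟨F, hF, rfl⟩
    obtain ⟨a, b, ha, hb, -, hF⟩ := hbdry F hF
    rw [SetLike.mem_coe, Submodule.mem_comap, hF]
    exact ⟨Submodule.sub_mem _ (hvert hb) (hvert ha), by simp [bdry_vertex]⟩
  have hφker : (chains K Δ 2).map (bdry K) ≤ LinearMap.ker φ := by
    rw [Submodule.map_le_iff_le_comap]
    refine Submodule.span_le.2 ?_
    rintro _ ⟨F, hF, rfl⟩
    obtain ⟨a, b, -, -, hab, hF⟩ := hbdry F hF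
    rw [SetLike.mem_coe, Submodule.mem_comap, hF, LinearMap.mem_ker, map_sub, hφ, hφ]
    simp [hab]
  have hfin : FiniteDimensional K ↥(chains K Δ 1 ⊓ LinearMap.ker (bdry K)) :=
    Submodule.finiteDimensional_inf_left _ _
  have heq := Submodule.eq_of_le_of_finrank_le hle (Nat.sub_eq_zero_iff_le.1 h)
  have hmem : Finsupp.single {v} (1 : K) - Finsupp.single {u} 1 ∈
      (chains K Δ 2).map (bdry K) := by
    rw [heq]
    exact ⟨Submodule.sub_mem _ (hvert hv) (hvert hu), by simp [bdry_vertex]⟩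
  have h0 := LinearMap.mem_ker.1 (hφker hmem)
  rw [map_sub, hφ, hφ, if_neg hcon, if_pos Relation.ReflTransGen.refl] at h0
  simp at h0

end Homology

/-! ### The function `macaulay2` -/

section Macaulay

theorem two_mul_succ_choose_two (n : ℕ) : 2 * (n + 1).choose 2 = (n + 1) * n := by
  induction n with
  | zero => simp
  | succ n ih => rw [Nat.choose_succ_succ' (n + 1) 1, Nat.choose_one_right]; linarith

theorem succ_choose_two (n : ℕ) : (n + 1).choose 2 = n.choose 2 + n := by
  rw [Nat.choose_succ_succ' n 1, Nat.choose_one_right, add_comm]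

theorem succ_choose_three (n : ℕ) : (n + 1).choose 3 = n.choose 3 + n.choose 2 := by
  rw [Nat.choose_succ_succ' n 2, add_comm]

theorem exists_eq_choose_two_add (a : ℕ) : ∃ b r, r ≤ b ∧ a = b.choose 2 + r := by
  induction a with
  | zero => exact ⟨0, 0, le_rfl, rfl⟩
  | succ a ih =>
    obtain ⟨b, r, hr, rfl⟩ := ih
    rcases hr.lt_or_eq with h | rfl
    · exact ⟨b, r + 1, h, rfl⟩
    · exact ⟨r + 1, 1, by omega, by rw [succ_choose_two]⟩

theorem macaulay2_of_lt {b r : ℕ} (hr : r < b) :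
    macaulay2 (b.choose 2 + r) = (b + 1).choose 3 + (r + 1).choose 2 := by
  rcases Nat.eq_zero_or_pos (b.choose 2 + r) with h0 | hpos
  · obtain ⟨h1, rfl⟩ : b.choose 2 = 0 ∧ r = 0 := by omega
    have : b < 2 := Nat.choose_eq_zero_iff.1 h1
    obtain rfl : b = 1 := by omega
    decide
  · have hb : Nat.findGreatest (fun t => t.choose 2 ≤ b.choose 2 + r) (b.choose 2 + r + 2) = b := by
      rw [Nat.findGreatest_eq_iff]
      have hsucc := succ_choose_two b
      refine ⟨?_, fun _ => by omega, fun m hm _ => ?_⟩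
      · obtain ⟨c, rfl⟩ : ∃ c, b = c + 1 := ⟨b - 1, by omega⟩
        have := two_mul_succ_choose_two c
        rcases le_or_gt c 1 with hc | hc
        · omega
        · nlinarith
      · have := Nat.choose_le_choose 2 (show b + 1 ≤ m from hm)
        omega
    simp only [macaulay2]
    rw [if_neg hpos.ne', hb, Nat.add_sub_cancel_left]

theorem macaulay2_eq {b r : ℕ} (hr : r ≤ b) :
    macaulay2 (b.choose 2 + r) = (b + 1).choose 3 + (r + 1).choose 2 := by
  rcases hr.lt_or_eq with h | rfl
  · exact macaulay2_of_lt h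
  · have h := macaulay2_of_lt (Nat.succ_pos r)
    rw [add_zero, succ_choose_two] at h
    rw [h, succ_choose_three (r + 1)]
    simp

theorem macaulay2_lt_succ (a : ℕ) : macaulay2 a + 1 ≤ macaulay2 (a + 1) := by
  obtain ⟨b, r, hr, rfl⟩ := exists_eq_choose_two_add a
  rcases hr.lt_or_eq with h | rfl
  · rw [add_assoc, macaulay2_eq hr, macaulay2_eq h, succ_choose_two (r + 1)]
    omega
  · have h := macaulay2_eq (show 1 ≤ r + 1 by omega)
    rw [succ_choose_two] at h
    rw [h, macaulay2_eq hr, succ_choose_three (r + 1)]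
    simp only [Nat.reduceAdd, Nat.choose_self]
    omega

theorem macaulay2_add_le {a x y : ℕ} (h1 : y ≤ (x + 1).choose 2) (h2 : y ≤ a + x) :
    macaulay2 a + y ≤ macaulay2 (a + x) := by
  obtain ⟨b, r, hr, rfl⟩ := exists_eq_choose_two_add a
  rcases le_or_gt x b with hx | hx
  · have hX := two_mul_succ_choose_two x
    have hR := two_mul_succ_choose_two r
    rcases le_or_gt (r + x) b with hb | hb
    · have hRX := two_mul_succ_choose_two (r + x)
      rw [macaulay2_eq hr, add_assoc (b.choose 2) r x, macaulay2_eq hb]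
      nlinarith
    · obtain ⟨s, hs⟩ : ∃ s, r + x = b + s := ⟨r + x - b, by omega⟩
      have hB := two_mul_succ_choose_two b
      have hS := two_mul_succ_choose_two s
      have hrep : b.choose 2 + r + x = (b + 1).choose 2 + s := by
        rw [succ_choose_two]; omega
      rw [hrep, macaulay2_eq hr, macaulay2_eq (show s ≤ b + 1 by omega),
        succ_choose_three (b + 1)]
      obtain ⟨u, rfl⟩ : ∃ u, b = r + u := ⟨b - r, by omega⟩
      obtain rfl : x = u + s := by omega
      obtain ⟨w, rfl⟩ : ∃ w, r = s + w := ⟨r - s, by omega⟩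
      nlinarith [Nat.zero_le (u * w)]
  · obtain ⟨k, rfl⟩ : ∃ k, x = b + 1 + k := ⟨x - (b + 1), by omega⟩
    clear h1
    induction k generalizing y with
    | zero =>
      have hrep : b.choose 2 + r + (b + 1 + 0) = (b + 1).choose 2 + (r + 1) := by
        rw [succ_choose_two]; omega
      have hB := succ_choose_two b
      rw [hrep, macaulay2_eq hr, macaulay2_eq (show r + 1 ≤ b + 1 by omega),
        succ_choose_three (b + 1), succ_choose_two (r + 1)]
      omega
    | succ k ih =>
      have h := ih (y := y - 1) (by omega) (by omega)
      have := macaulay2_lt_succ (b.choose 2 + r + (b + 1 + k))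
      rw [show b.choose 2 + r + (b + 1 + (k + 1)) = b.choose 2 + r + (b + 1 + k) + 1 by omega]
      omega

end Macaulay

/-! ### Necessity -/

section Necessity

/-- the faces of `Δ` with `m` vertices, all of them in `W` -/
def facesIn (Δ : Finset (Finset ℕ)) (m : ℕ) (W : Finset ℕ) : Finset (Finset ℕ) :=
  (facesOf Δ m).filter (· ⊆ W)

/-- the vertices of `W` that are adjacent to `y` in `Δ` -/
def neighborsIn (Δ : Finset (Finset ℕ)) (y : ℕ) (W : Finset ℕ) : Finset ℕ :=
  W.filter fun u => {y, u} ∈ Δ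

variable {Δ : Finset (Finset ℕ)}

theorem mem_facesIn {m : ℕ} {W F : Finset ℕ} :
    F ∈ facesIn Δ m W ↔ F ∈ Δ ∧ F.card = m ∧ F ⊆ W := by
  simp [facesIn, facesOf, and_assoc]

theorem card_facesIn_le (m : ℕ) (W : Finset ℕ) : (facesIn Δ m W).card ≤ W.card.choose m := by
  rw [← Finset.card_powersetCard]
  refine Finset.card_le_card fun F hF => ?_
  rw [mem_facesIn] at hF
  exact Finset.mem_powersetCard.2 ⟨hF.2.2, hF.2.1⟩

theorem card_facesIn_two_insert {y : ℕ} {W : Finset ℕ} (hy : y ∉ W) :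
    (facesIn Δ 2 (insert y W)).card = (facesIn Δ 2 W).card + (neighborsIn Δ y W).card := by
  have hinj : Set.InjOn (fun u => ({y, u} : Finset ℕ)) (neighborsIn Δ y W) := by
    intro u hu v hv huv
    have h1 : u ∈ W := (Finset.mem_filter.1 hu).1
    have h2 : u ∈ ({y, v} : Finset ℕ) := by simp [← show ({y, u} : Finset ℕ) = {y, v} from huv]
    rcases Finset.mem_insert.1 h2 with rfl | h
    · exact absurd h1 hy
    · exact Finset.mem_singleton.1 h
  rw [← Finset.card_image_of_injOn hinj, ← Finset.card_union_of_disjoint]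
  · congr 1
    ext F
    simp only [Finset.mem_union, mem_facesIn, Finset.mem_image, neighborsIn, Finset.mem_filter]
    constructor
    · rintro ⟨hF, h2, hsub⟩
      by_cases hyF : y ∈ F
      · right
        obtain ⟨u, hu⟩ := Finset.card_eq_one.1
          (show (F.erase y).card = 1 by rw [Finset.card_erase_of_mem hyF, h2])
        have hF' : {y, u} = F := by rw [← Finset.insert_erase hyF, hu]
        refine ⟨u, ⟨?_, hF' ▸ hF⟩, hF'⟩
        have : u ∈ F.erase y := by simp [hu]
        exact (Finset.mem_insert.1 (hsub (Finset.mem_of_mem_erase this))).resolve_left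
          (Finset.ne_of_mem_erase this)
      · exact Or.inl ⟨hF, h2, (Finset.subset_insert_iff_of_notMem hyF).1 hsub⟩
    · rintro (⟨hF, h2, hsub⟩ | ⟨u, ⟨hu, hF⟩, rfl⟩)
      · exact ⟨hF, h2, hsub.trans (Finset.subset_insert _ _)⟩
      · refine ⟨hF, Finset.card_pair (by rintro rfl; exact hy hu), ?_⟩
        exact Finset.insert_subset_insert _ (Finset.singleton_subset_iff.2 hu)
  · rw [Finset.disjoint_left]
    intro F hF hF'
    obtain ⟨u, -, rfl⟩ := Finset.mem_image.1 hF'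
    exact hy ((mem_facesIn.1 hF).2.2 (by simp))

theorem card_facesIn_three_insert_le (hΔ : ∀ F ∈ Δ, ∀ G ⊆ F, G ∈ Δ) {y : ℕ} {W : Finset ℕ} :
    (facesIn Δ 3 (insert y W)).card ≤
      (facesIn Δ 3 W).card + (facesIn Δ 2 (neighborsIn Δ y W)).card := by
  have hsub : facesIn Δ 3 (insert y W) ⊆
      facesIn Δ 3 W ∪ (facesIn Δ 2 (neighborsIn Δ y W)).image (insert y) := by
    intro F hF
    obtain ⟨hF, h3, hsub⟩ := mem_facesIn.1 hF
    by_cases hyF : y ∈ F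
    · refine Finset.mem_union_right _ (Finset.mem_image.2 ⟨F.erase y, mem_facesIn.2
        ⟨hΔ F hF _ (Finset.erase_subset _ _), by rw [Finset.card_erase_of_mem hyF, h3], ?_⟩,
        Finset.insert_erase hyF⟩)
      intro u hu
      have huF := Finset.mem_of_mem_erase hu
      refine Finset.mem_filter.2 ⟨(Finset.mem_insert.1 (hsub huF)).resolve_left
        (Finset.ne_of_mem_erase hu), hΔ F hF _ ?_⟩
      exact Finset.insert_subset hyF (Finset.singleton_subset_iff.2 huF)
    · exact Finset.mem_union_left _
        (mem_facesIn.2 ⟨hF, h3, (Finset.subset_insert_iff_of_notMem hyF).1 hsub⟩)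
  exact (Finset.card_le_card hsub).trans
    ((Finset.card_union_le _ _).trans (Nat.add_le_add_left Finset.card_image_le _))

/-- The face counts of the restriction `Δ|_W` obey the upper bounds forced by building it up
one vertex at a time, each new vertex having at least two earlier neighbours. -/
structure Sparse (Δ : Finset (Finset ℕ)) (W : Finset ℕ) : Prop where
  two_le : 2 ≤ W.card
  edges : 2 * W.card ≤ (facesIn Δ 2 W).card + 3
  triangles : (facesIn Δ 3 W).card + W.card ≤
    (facesIn Δ 2 W).card + 1 + macaulay2 ((facesIn Δ 2 W).card + 3 - 2 * W.card)
  subset : ∀ U ⊆ W, 2 ≤ U.card →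
    (facesIn Δ 2 U).card + 2 * W.card ≤ 2 * U.card + (facesIn Δ 2 W).card

theorem Sparse.pair {u v : ℕ} (huv : u ≠ v) (h : {u, v} ∈ Δ) : Sparse Δ {u, v} := by
  have h2 : (facesIn Δ 2 {u, v}).card = 1 := by
    refine le_antisymm ((card_facesIn_le _ _).trans (by simp [Finset.card_pair huv])) ?_
    exact Finset.card_pos.2 ⟨{u, v}, mem_facesIn.2 ⟨h, Finset.card_pair huv, subset_rfl⟩⟩
  have h3 : (facesIn Δ 3 {u, v}).card = 0 :=
    Nat.le_zero.1 ((card_facesIn_le _ _).trans (by simp [Finset.card_pair huv]))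
  refine ⟨?_, ?_, ?_, ?_⟩
  · rw [Finset.card_pair huv]
  · rw [Finset.card_pair huv, h2]
  · rw [Finset.card_pair huv, h2, h3]; omega
  · intro U hU hU2
    rw [Finset.eq_of_subset_of_card_le hU (by rwa [Finset.card_pair huv]), add_comm]

theorem Sparse.insert (hΔ : ∀ F ∈ Δ, ∀ G ⊆ F, G ∈ Δ) {W : Finset ℕ} (h : Sparse Δ W) {y : ℕ}
    (hy : y ∉ W) (hd : 2 ≤ (neighborsIn Δ y W).card) : Sparse Δ (insert y W) := by
  obtain ⟨x, hx⟩ : ∃ x, (neighborsIn Δ y W).card = x + 2 := ⟨_, (Nat.sub_add_cancel hd).symm⟩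
  have he := card_facesIn_two_insert (Δ := Δ) hy
  have hc := Finset.card_insert_of_notMem hy
  refine ⟨by have := h.two_le; omega, by have := h.edges; omega, ?_, ?_⟩
  · have ht := card_facesIn_three_insert_le hΔ (y := y) (W := W)
    have h1 := card_facesIn_le (Δ := Δ) 2 (neighborsIn Δ y W)
    have h2 := h.subset _ (Finset.filter_subset _ W) hd
    rw [← neighborsIn] at h2
    obtain ⟨a, ha⟩ : ∃ a, (facesIn Δ 2 W).card + 3 = 2 * W.card + a :=
      ⟨_, (Nat.add_sub_cancel' h.edges).symm⟩
    have h3 := h.triangles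
    rw [show (facesIn Δ 2 W).card + 3 - 2 * W.card = a by omega] at h3
    rw [show (facesIn Δ 2 (Insert.insert y W)).card + 3 - 2 * (Insert.insert y W).card = a + x
      by omega]
    rw [hx, succ_choose_two (x + 1)] at h1
    have := macaulay2_add_le (a := a) (x := x)
      (y := (facesIn Δ 2 (neighborsIn Δ y W)).card - (x + 1)) (by omega) (by omega)
    omega
  · intro U hU hU2
    by_cases hyU : y ∈ U
    · have h1 := Finset.card_erase_add_one hyU
      have h2 := card_facesIn_two_insert (Δ := Δ) (Finset.notMem_erase y U)
      rw [Finset.insert_erase hyU] at h2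
      have hUW : U.erase y ⊆ W := Finset.subset_insert_iff.1 hU
      have h3 : (neighborsIn Δ y (U.erase y)).card ≤ (neighborsIn Δ y W).card :=
        Finset.card_le_card (Finset.filter_subset_filter _ hUW)
      rcases Nat.lt_or_ge (U.erase y).card 2 with h4 | h4
      · have h5 := card_facesIn_le (Δ := Δ) 2 U
        rw [show U.card = 2 by omega] at h5 ⊢
        have := h.edges
        simp only [Nat.choose_self] at h5
        omega
      · have := h.subset _ hUW h4
        omega
    · have := h.subset U ((Finset.subset_insert_iff_of_notMem hyU).1 hU) hU2
      omega

theorem exists_step_out {r : ℕ → ℕ → Prop} {W : Finset ℕ} {a b : ℕ}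
    (h : Relation.ReflTransGen r a b) (ha : a ∈ W) (hb : b ∉ W) :
    ∃ x ∈ W, ∃ y, y ∉ W ∧ r x y := by
  induction h with
  | refl => exact absurd ha hb
  | @tail c d _ hcd ih =>
    by_cases hc : c ∈ W
    · exact ⟨c, hc, d, hb, hcd⟩
    · exact ih hc

theorem exists_two_neighbors (hΔ : ∀ F ∈ Δ, ∀ G ⊆ F, G ∈ Δ) (hconn : IsConnectedComplex Δ)
    (hlink : ∀ v, {v} ∈ Δ → IsConnectedComplex (link Δ {v})) {W : Finset ℕ}
    (hW : ∀ u ∈ W, ∃ v ∈ W, u ≠ v ∧ {u, v} ∈ Δ) {u₀ v₀ : ℕ} (hu₀ : u₀ ∈ W)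
    (hv₀ : v₀ ∉ W) (hv₀Δ : {v₀} ∈ Δ) :
    ∃ y, y ∉ W ∧ 2 ≤ (neighborsIn Δ y W).card := by
  have hsing {u v : ℕ} (h : ({u, v} : Finset ℕ) ∈ Δ) : {u} ∈ Δ := hΔ _ h _ (by simp)
  have hlk {u v : ℕ} (hne : u ≠ v) (h : ({u, v} : Finset ℕ) ∈ Δ) : {v} ∈ link Δ {u} :=
    Finset.mem_filter.2 ⟨hΔ _ h _ (by simp), by simpa using hne.symm,
      by rwa [Finset.singleton_union, Finset.pair_comm]⟩
  obtain ⟨w₀, -, -, huw₀⟩ := hW u₀ hu₀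
  obtain ⟨u, hu, w, hw, huw, huwΔ⟩ := exists_step_out (hconn u₀ v₀ (hsing huw₀) hv₀Δ) hu₀ hv₀
  obtain ⟨v, hv, huv, huvΔ⟩ := hW u hu
  obtain ⟨x, hx, y, hy, hxy, hxyΔ⟩ := exists_step_out
    (hlink u (hsing huwΔ) v w (hlk huv huvΔ) (hlk huw huwΔ)) hv hw
  obtain ⟨-, hdisj, hxyu⟩ := Finset.mem_filter.1 hxyΔ
  have hxu : u ≠ x := by
    rintro rfl
    simp at hdisj
  refine ⟨y, hy, ?_⟩
  rw [← Finset.card_pair hxu]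
  refine Finset.card_le_card (Finset.insert_subset ?_ (Finset.singleton_subset_iff.2 ?_))
  · refine Finset.mem_filter.2 ⟨hu, hΔ _ hxyu _ ?_⟩
    intro z; simp; tauto
  · refine Finset.mem_filter.2 ⟨hx, hΔ _ hxyu _ ?_⟩
    intro z; simp; tauto

theorem sparse_Icc {n : ℕ} (hΔ : IsComplexOn n Δ) (hconn : IsConnectedComplex Δ)
    (hlink : ∀ v, {v} ∈ Δ → IsConnectedComplex (link Δ {v})) {u v : ℕ} (huv : u ≠ v)
    (h : {u, v} ∈ Δ) : Sparse Δ (Finset.Icc 1 n) := by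
  classical
  obtain ⟨hdown, hsub, hsing⟩ := hΔ
  let S := (Finset.Icc 1 n).powerset.filter fun W =>
    Sparse Δ W ∧ ∀ u ∈ W, ∃ v ∈ W, u ≠ v ∧ {u, v} ∈ Δ
  have hS : ({u, v} : Finset ℕ) ∈ S := by
    refine Finset.mem_filter.2 ⟨Finset.mem_powerset.2 (hsub _ h), Sparse.pair huv h, ?_⟩
    intro w hw
    rcases Finset.mem_insert.1 hw with rfl | hw
    · exact ⟨v, by simp, huv, h⟩
    · rw [Finset.mem_singleton] at hw
      subst hw
      exact ⟨u, by simp, huv.symm, by rwa [Finset.pair_comm]⟩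
  obtain ⟨W, hW, hmax⟩ := S.exists_max_image Finset.card ⟨_, hS⟩
  obtain ⟨hWn, hsp, hnb⟩ := Finset.mem_filter.1 hW
  rw [Finset.mem_powerset] at hWn
  by_cases hall : Finset.Icc 1 n ⊆ W
  · rwa [← Finset.Subset.antisymm hWn hall]
  obtain ⟨v₀, hv₀n, hv₀⟩ := Finset.not_subset.1 hall
  obtain ⟨u₀, hu₀⟩ : W.Nonempty := Finset.card_pos.1 (by have := hsp.two_le; omega)
  obtain ⟨y, hy, hd⟩ := exists_two_neighbors hdown hconn hlink hnb hu₀ hv₀ (hsing _ hv₀n)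
  obtain ⟨z, hz⟩ : (neighborsIn Δ y W).Nonempty := Finset.card_pos.1 (by omega)
  obtain ⟨hzW, hyz⟩ := Finset.mem_filter.1 hz
  have hne : y ≠ z := by rintro rfl; exact hy hzW
  have := hmax (insert y W) (Finset.mem_filter.2 ⟨Finset.mem_powerset.2
    (Finset.insert_subset (hsub _ hyz y (by simp)) hWn), hsp.insert hdown hy hd, ?_⟩)
  · rw [Finset.card_insert_of_notMem hy] at this
    omega
  · intro w hw
    rcases Finset.mem_insert.1 hw with rfl | hw
    · exact ⟨z, Finset.mem_insert_of_mem hzW, hne, hyz⟩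
    · obtain ⟨t, ht, h⟩ := hnb w hw
      exact ⟨t, Finset.mem_insert_of_mem ht, h⟩

end Necessity

section BuchsbaumComplexes

variable {Δ : Finset (Finset ℕ)}

theorem card_facesOf_one_le (hconn : IsConnectedComplex Δ) (hΔ : ∀ F ∈ Δ, ∀ G ⊆ F, G ∈ Δ) :
    (facesOf Δ 1).card ≤ (facesOf Δ 2).card + 1 := by
  classical
  set V := (facesOf Δ 1).biUnion id with hV
  have hmemV {v : ℕ} : v ∈ V ↔ {v} ∈ Δ := by
    simp only [hV, Finset.mem_biUnion, id, facesOf, Finset.mem_filter]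
    constructor
    · rintro ⟨F, ⟨hF, -⟩, hv⟩
      exact hΔ F hF _ (Finset.singleton_subset_iff.2 hv)
    · exact fun h => ⟨{v}, ⟨h, Finset.card_singleton v⟩, Finset.mem_singleton_self v⟩
  have hle : (facesOf Δ 1).card ≤ V.card := by
    rw [← Finset.card_image_of_injective V Finset.singleton_injective]
    refine Finset.card_le_card fun F hF => ?_
    obtain ⟨hF, h1⟩ := Finset.mem_filter.1 hF
    obtain ⟨v, rfl⟩ := Finset.card_eq_one.1 h1
    exact Finset.mem_image_of_mem _ (hmemV.2 hF)
  rcases V.eq_empty_or_nonempty with h0 | ⟨u, hu⟩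
  · simp [h0] at hle
    simp [hle]
  let S := V.powerset.filter fun W => W.Nonempty ∧ W.card ≤ (facesIn Δ 2 W).card + 1
  have hS : ({u} : Finset ℕ) ∈ S := Finset.mem_filter.2
    ⟨Finset.mem_powerset.2 (Finset.singleton_subset_iff.2 hu), ⟨u, by simp⟩, by simp⟩
  obtain ⟨W, hW, hmax⟩ := S.exists_max_image Finset.card ⟨_, hS⟩
  obtain ⟨hWV, ⟨u₀, hu₀⟩, hcard⟩ := Finset.mem_filter.1 hW
  rw [Finset.mem_powerset] at hWV
  have hVW : V ⊆ W := by
    by_contra hall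
    obtain ⟨v₀, hv₀V, hv₀⟩ := Finset.not_subset.1 hall
    obtain ⟨x, hx, y, hy, hxy, hxyΔ⟩ := exists_step_out
      (hconn u₀ v₀ (hmemV.1 (hWV hu₀)) (hmemV.1 hv₀V)) hu₀ hv₀
    have hpos : 0 < (neighborsIn Δ y W).card :=
      Finset.card_pos.2 ⟨x, Finset.mem_filter.2 ⟨hx, by rwa [Finset.pair_comm]⟩⟩
    have he := card_facesIn_two_insert (Δ := Δ) hy
    have hc := Finset.card_insert_of_notMem hy
    have hyV : y ∈ V := hmemV.2 (hΔ _ hxyΔ _ (by simp))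
    have := hmax (insert y W) (Finset.mem_filter.2 ⟨Finset.mem_powerset.2
      (Finset.insert_subset hyV hWV), ⟨y, by simp⟩, by omega⟩)
    omega
  calc (facesOf Δ 1).card ≤ V.card := hle
    _ ≤ W.card := Finset.card_le_card hVW
    _ ≤ (facesIn Δ 2 W).card + 1 := hcard
    _ ≤ (facesOf Δ 2).card + 1 := Nat.add_le_add_right (Finset.card_filter_le _ _) 1

theorem mem_link_singleton {v : ℕ} {G : Finset ℕ} (hΔ : ∀ F ∈ Δ, ∀ G ⊆ F, G ∈ Δ) :
    G ∈ link Δ {v} ↔ v ∉ G ∧ insert v G ∈ Δ := by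
  rw [link, Finset.mem_filter, Finset.disjoint_singleton_right, Finset.union_comm,
    ← Finset.insert_eq]
  exact ⟨fun h => h.2, fun h => ⟨hΔ _ h.2 _ (Finset.subset_insert _ _), h⟩⟩

theorem link_isLowerSet (hΔ : ∀ F ∈ Δ, ∀ G ⊆ F, G ∈ Δ) (v : ℕ) :
    ∀ F ∈ link Δ {v}, ∀ G ⊆ F, G ∈ link Δ {v} := by
  intro F hF G hG
  rw [mem_link_singleton hΔ] at hF ⊢
  exact ⟨fun h => hF.1 (hG h), hΔ _ hF.2 _ (Finset.insert_subset_insert _ hG)⟩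

theorem card_facesOf_link (hΔ : ∀ F ∈ Δ, ∀ G ⊆ F, G ∈ Δ) (v m : ℕ) :
    (facesOf (link Δ {v}) m).card = ((facesOf Δ (m + 1)).filter (v ∈ ·)).card := by
  refine Finset.card_bij' (fun G _ => insert v G) (fun F _ => F.erase v) ?_ ?_ ?_ ?_
  · intro G hG
    obtain ⟨hG, hm⟩ := Finset.mem_filter.1 hG
    obtain ⟨hv, hG⟩ := (mem_link_singleton hΔ).1 hG
    exact Finset.mem_filter.2 ⟨Finset.mem_filter.2 ⟨hG, by
      rw [Finset.card_insert_of_notMem hv, hm]⟩, by simp⟩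
  · intro F hF
    obtain ⟨hF, hv⟩ := Finset.mem_filter.1 hF
    obtain ⟨hF, hm⟩ := Finset.mem_filter.1 hF
    exact Finset.mem_filter.2 ⟨(mem_link_singleton hΔ).2 ⟨by simp, by
      rwa [Finset.insert_erase hv]⟩, by rw [Finset.card_erase_of_mem hv, hm]; rfl⟩
  · intro G hG
    obtain ⟨hG, -⟩ := Finset.mem_filter.1 hG
    exact Finset.erase_insert ((mem_link_singleton hΔ).1 hG).1
  · intro F hF
    exact Finset.insert_erase (Finset.mem_filter.1 hF).2

theorem sum_card_filter_mem {n : ℕ} (hsub : ∀ F ∈ Δ, ∀ i ∈ F, i ∈ Finset.Icc 1 n) (m : ℕ) :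
    ∑ v ∈ Finset.Icc 1 n, ((facesOf Δ m).filter (v ∈ ·)).card = (facesOf Δ m).card * m := by
  have h := Finset.sum_card_bipartiteAbove_eq_sum_card_bipartiteBelow
    (s := Finset.Icc 1 n) (t := facesOf Δ m) (fun v F => v ∈ F)
  refine h.trans (Finset.sum_const_nat fun F hF => ?_)
  obtain ⟨hF, hm⟩ := Finset.mem_filter.1 hF
  rw [← hm, Finset.bipartiteBelow, Finset.filter_mem_eq_inter, Finset.inter_eq_right.2 (hsub F hF)]

theorem card_facesOf_one {n : ℕ} (hΔ : IsComplexOn n Δ) : (facesOf Δ 1).card = n := by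
  have : facesOf Δ 1 = (Finset.Icc 1 n).image fun v => {v} := by
    ext F
    simp only [facesOf, Finset.mem_filter, Finset.mem_image]
    constructor
    · rintro ⟨hF, h1⟩
      obtain ⟨v, rfl⟩ := Finset.card_eq_one.1 h1
      exact ⟨v, hΔ.2.1 _ hF v (by simp), rfl⟩
    · rintro ⟨v, hv, rfl⟩
      exact ⟨hΔ.2.2 v hv, by simp⟩
  rw [this, Finset.card_image_of_injective _ Finset.singleton_injective, Nat.card_Icc]
  omega

theorem two_mul_edges_le {n : ℕ} (hΔ : IsComplexOn n Δ)
    (hlink : ∀ v, {v} ∈ Δ → IsConnectedComplex (link Δ {v})) :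
    2 * (facesOf Δ 2).card ≤ 3 * (facesOf Δ 3).card + n := by
  have h2 := sum_card_filter_mem hΔ.2.1 2
  have h3 := sum_card_filter_mem hΔ.2.1 3
  have hle : ∑ v ∈ Finset.Icc 1 n, ((facesOf Δ 2).filter (v ∈ ·)).card ≤
      ∑ v ∈ Finset.Icc 1 n, (((facesOf Δ 3).filter (v ∈ ·)).card + 1) := by
    refine Finset.sum_le_sum fun v hv => ?_
    rw [← card_facesOf_link hΔ.1 v 1, ← card_facesOf_link hΔ.1 v 2]
    exact card_facesOf_one_le (hlink v (hΔ.2.2 v hv)) (link_isLowerSet hΔ.1 v)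
  rw [Finset.sum_add_distrib, h2, h3] at hle
  simp at hle
  omega

theorem hVector3_iff {n : ℕ} (hΔ : IsComplexOn n Δ) (h1 h2 h3 : ℤ) :
    hVector3 Δ 1 h1 h2 h3 ↔ h1 = n - 3 ∧ h2 = (facesOf Δ 2).card - 2 * n + 3 ∧
      h3 = (facesOf Δ 3).card - (facesOf Δ 2).card + n - 1 := by
  simp [hVector3, hVec, fVec, Finset.sum_range_succ, card_facesOf_one hΔ]
  constructor
  · rintro ⟨rfl, rfl, rfl⟩
    refine ⟨?_, ?_, ?_⟩ <;> ring
  · rintro ⟨rfl, rfl, rfl⟩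
    refine ⟨?_, ?_, ?_⟩ <;> ring

theorem sup_card_of_dimZ (hdim : dimZ Δ = 2) : Δ.sup Finset.card = 3 := by
  unfold dimZ at hdim
  omega

theorem exists_triangle_of_isPure (hdim : dimZ Δ = 2) (hpure : IsPure Δ) {F : Finset ℕ}
    (hF : F ∈ Δ) : ∃ t ∈ Δ, F ⊆ t ∧ t.card = 3 := by
  obtain ⟨t, hFt, ht⟩ := Finset.exists_le_maximal Δ hF
  refine ⟨t, ht.prop, hFt, ?_⟩
  rw [hpure t ht.prop fun G hG h => ht.eq_of_le hG h, sup_card_of_dimZ hdim]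

theorem link_empty : link Δ ∅ = Δ := by
  ext G
  simp [link]

theorem isConnectedComplex_link (K : Type) [Field K] {n : ℕ} (hΔ : IsComplexOn n Δ)
    (hdim : dimZ Δ = 2) (hB : IsBuchsbaum K Δ) (v : ℕ) (hv : {v} ∈ Δ) :
    IsConnectedComplex (link Δ {v}) := by
  apply isConnectedComplex_of_homDim K (link_isLowerSet hΔ.1 v)
  have hempty : ∅ ∈ link Δ {v} := (mem_link_singleton hΔ.1).2 ⟨by simp, by simpa using hv⟩
  obtain ⟨t, ht, hvt, h3⟩ := exists_triangle_of_isPure hdim hB.1 hv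
  rw [Finset.singleton_subset_iff] at hvt
  have hmem : t.erase v ∈ link Δ {v} :=
    (mem_link_singleton hΔ.1).2 ⟨by simp, by rwa [Finset.insert_erase hvt]⟩
  have hsup := Finset.le_sup (f := Finset.card) hmem
  rw [Finset.card_erase_of_mem hvt, h3] at hsup
  have h0 := hB.2 v hv ∅ hempty 0 (by
    unfold dimZ
    rw [Finset.card_empty]
    omega)
  rw [link_empty] at h0
  simpa [betti] using h0

theorem hVector3_bounds_of_isBuchsbaum (K : Type) [Field K] {n : ℕ} (hΔ : IsComplexOn n Δ)
    (hdim : dimZ Δ = 2) (hconn : IsConnectedComplex Δ) (hB : IsBuchsbaum K Δ) {h1 h2 h3 : ℤ}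
    (hvec : hVector3 Δ 1 h1 h2 h3) :
    0 ≤ h1 ∧ 0 ≤ h2 ∧ h2 ≤ (((h1 + 1).toNat.choose 2 : ℕ) : ℤ) ∧ -h2 ≤ 3 * h3 ∧
      h3 ≤ ((macaulay2 h2.toNat : ℕ) : ℤ) := by
  have hlink := isConnectedComplex_link K hΔ hdim hB
  obtain ⟨rfl, rfl, rfl⟩ := (hVector3_iff hΔ h1 h2 h3).1 hvec
  obtain ⟨t, ht, h3⟩ : ∃ t ∈ Δ, t.card = 3 := by
    have hne : Δ.Nonempty := by
      rw [Finset.nonempty_iff_ne_empty]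
      rintro rfl
      simp [dimZ] at hdim
    obtain ⟨F, hF⟩ := hne
    obtain ⟨t, ht, -, h3⟩ := exists_triangle_of_isPure hdim hB.1 hF
    exact ⟨t, ht, h3⟩
  have hn : 3 ≤ n := by
    have := Finset.card_le_card (show t ⊆ Finset.Icc 1 n from hΔ.2.1 t ht)
    rw [Nat.card_Icc, h3] at this
    omega
  obtain ⟨x, y, z, hxy, -, -, rfl⟩ := Finset.card_eq_three.1 h3
  have hsp := sparse_Icc hΔ hconn hlink hxy (hΔ.1 _ ht _ (by intro; simp; tauto))
  have hin (m : ℕ) : facesIn Δ m (Finset.Icc 1 n) = facesOf Δ m := by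
    refine Finset.filter_true_of_mem fun F hF => ?_
    exact hΔ.2.1 F (Finset.mem_filter.1 hF).1
  have hcard : (Finset.Icc 1 n).card = n := by simp
  have hE := hsp.edges
  have hT := hsp.triangles
  have hmax := card_facesIn_le (Δ := Δ) 2 (Finset.Icc 1 n)
  rw [hin, hcard] at hE hmax
  rw [hin, hin, hcard] at hT
  have hlow := two_mul_edges_le hΔ hlink
  obtain ⟨m, rfl⟩ : ∃ m, n = m + 3 := ⟨n - 3, by omega⟩
  have c1 : (m + 3).choose 2 = (m + 2).choose 2 + (m + 2) := succ_choose_two (m + 2)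
  have c2 : (m + 2).choose 2 = (m + 1).choose 2 + (m + 1) := succ_choose_two (m + 1)
  have e1 : (((m + 3 : ℕ) : ℤ) - 3 + 1).toNat = m + 1 := by omega
  have e2 : (((facesOf Δ 2).card : ℤ) - 2 * (m + 3 : ℕ) + 3).toNat =
    (facesOf Δ 2).card + 3 - 2 * (m + 3) := by omega
  rw [e1, e2]
  refine ⟨by omega, by omega, by omega, by omega, by omega⟩

end BuchsbaumComplexes

section WellLinkedTriangles

open Relation

/-- The pairs contained in a member of `T`. -/
def edgesOf (T : Finset (Finset ℕ)) : Finset (Finset ℕ) := T.biUnion (Finset.powersetCard 2)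

/-- `a` and `b` are joined by a path in the link of `x` in the complex generated by the
triangles `T`. -/
def LinkPath (T : Finset (Finset ℕ)) (x : ℕ) : ℕ → ℕ → Prop :=
  ReflTransGen fun a b => ({x, a, b} : Finset ℕ) ∈ T

/-- `T` is the set of triangles of a pure two-dimensional connected complex on `[n]` all of whose
vertex links are connected. -/
structure WellLinked (n : ℕ) (T : Finset (Finset ℕ)) : Prop where
  two_le : 2 ≤ n
  card_eq : ∀ t ∈ T, t.card = 3
  subset : ∀ t ∈ T, t ⊆ Finset.Icc 1 n
  link_conn : ∀ x a b, {x, a} ∈ edgesOf T → {x, b} ∈ edgesOf T → LinkPath T x a b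
  conn : ∀ u ∈ Finset.Icc 1 n, ∀ v ∈ Finset.Icc 1 n,
    ReflTransGen (fun a b => ({a, b} : Finset ℕ) ∈ edgesOf T) u v

variable {T S : Finset (Finset ℕ)} {n : ℕ}

theorem mem_edgesOf {e : Finset ℕ} : e ∈ edgesOf T ↔ ∃ t ∈ T, e ⊆ t ∧ e.card = 2 := by
  simp [edgesOf, Finset.mem_powersetCard]

theorem edgesOf_mono (h : T ⊆ S) : edgesOf T ⊆ edgesOf S :=
  Finset.biUnion_subset_biUnion_of_subset_left _ h

theorem edgesOf_insert (t : Finset ℕ) (T : Finset (Finset ℕ)) :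
    edgesOf (insert t T) = Finset.powersetCard 2 t ∪ edgesOf T := by
  simp [edgesOf]

theorem ne_of_pair_mem_edgesOf {a b : ℕ} (h : {a, b} ∈ edgesOf T) : a ≠ b := by
  obtain ⟨t, -, -, h2⟩ := mem_edgesOf.1 h
  rintro rfl
  simp at h2

theorem pair_mem_edgesOf {t : Finset ℕ} (ht : t ∈ T) {a b : ℕ} (ha : a ∈ t) (hb : b ∈ t)
    (hab : a ≠ b) : {a, b} ∈ edgesOf T :=
  mem_edgesOf.2 ⟨t, ht, Finset.insert_subset ha (Finset.singleton_subset_iff.2 hb),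
    Finset.card_pair hab⟩

theorem LinkPath.mono {x a b : ℕ} (h : LinkPath T x a b) (hTS : T ⊆ S) : LinkPath S x a b :=
  ReflTransGen.mono (fun _ _ h => hTS h) _ _ h

theorem LinkPath.symm {x a b : ℕ} (h : LinkPath T x a b) : LinkPath T x b a := by
  have : Std.Symm fun a b => ({x, a, b} : Finset ℕ) ∈ T :=
    ⟨fun a b hab => by rwa [Finset.pair_comm]⟩
  exact ReflTransGen.stdSymm.symm _ _ h

theorem LinkPath.single {x a b : ℕ} (h : {x, a, b} ∈ T) : LinkPath T x a b :=
  ReflTransGen.single h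

theorem ne_of_card_eq_three {a b c : ℕ} (h : ({a, b, c} : Finset ℕ).card = 3) :
    a ≠ b ∧ a ≠ c ∧ b ≠ c := by
  refine ⟨?_, ?_, ?_⟩ <;> rintro rfl
  · rw [Finset.insert_idem] at h
    exact absurd h (by have := Finset.card_le_two (a := a) (b := c); omega)
  · rw [Finset.insert_comm, Finset.pair_eq_singleton] at h
    exact absurd h (by have := Finset.card_le_two (a := b) (b := a); omega)
  · rw [Finset.pair_eq_singleton] at h
    exact absurd h (by have := Finset.card_le_two (a := a) (b := b); omega)

theorem exists_third {t : Finset ℕ} (ht : t.card = 3) {a b : ℕ} (ha : a ∈ t) (hb : b ∈ t)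
    (hab : a ≠ b) : ∃ c, t = {a, b, c} := by
  have h2 : ((t.erase a).erase b).card = 1 := by
    rw [Finset.card_erase_of_mem (Finset.mem_erase.2 ⟨hab.symm, hb⟩), Finset.card_erase_of_mem ha,
      ht]
  obtain ⟨c, hc⟩ := Finset.card_eq_one.1 h2
  refine ⟨c, ?_⟩
  rw [← hc, Finset.insert_erase (Finset.mem_erase.2 ⟨hab.symm, hb⟩), Finset.insert_erase ha]

namespace WellLinked

theorem mem_Icc_of_edge (h : WellLinked n T) {a b : ℕ} (hab : {a, b} ∈ edgesOf T) :
    a ∈ Finset.Icc 1 n ∧ b ∈ Finset.Icc 1 n := by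
  obtain ⟨t, ht, hs, -⟩ := mem_edgesOf.1 hab
  exact ⟨h.subset t ht (hs (by simp)), h.subset t ht (hs (by simp))⟩

theorem exists_edge (h : WellLinked n T) {v : ℕ} (hv : v ∈ Finset.Icc 1 n) :
    ∃ u, {v, u} ∈ edgesOf T := by
  have h2 := h.two_le
  obtain ⟨w, hw, hne⟩ : ∃ w ∈ Finset.Icc 1 n, v ≠ w := by
    by_cases h1 : v = 1
    · exact ⟨2, by simp; omega, by omega⟩
    · exact ⟨1, by simp; omega, h1⟩
  obtain rfl | ⟨u, hu, -⟩ := ReflTransGen.cases_head (h.conn v hv w hw)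
  · exact absurd rfl hne
  · exact ⟨u, hu⟩

theorem of_subset (h : WellLinked n T) (hTS : T ⊆ S) (hcard : ∀ t ∈ S, t.card = 3)
    (hedges : edgesOf S ⊆ edgesOf T) : WellLinked n S where
  two_le := h.two_le
  card_eq := hcard
  subset t ht a ha := by
    have h1 : 1 < t.card := by rw [hcard t ht]; omega
    obtain ⟨b, hb, hne⟩ := Finset.exists_mem_ne h1 a
    exact (h.mem_Icc_of_edge (hedges (pair_mem_edgesOf ht ha hb hne.symm))).1
  link_conn x a b ha hb := (h.link_conn x a b (hedges ha) (hedges hb)).mono hTS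
  conn u hu v hv := ReflTransGen.mono (fun _ _ h => edgesOf_mono hTS h) _ _ (h.conn u hu v hv)

theorem insert_of_link {m : ℕ} (h : WellLinked n T) (hnm : n ≤ m) {t : Finset ℕ}
    (hcard : t.card = 3) (hsub : t ⊆ Finset.Icc 1 m)
    (hcov : ∀ v ∈ Finset.Icc 1 m, v ∈ Finset.Icc 1 n ∨ v ∈ t)
    (hmeet : ∃ v ∈ t, v ∈ Finset.Icc 1 n)
    (hlink : ∀ u v w, t = {u, v, w} → {u, v} ∈ edgesOf T ∨ {u, w} ∈ edgesOf T ∨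
      ∀ a, {u, a} ∉ edgesOf T) :
    WellLinked m (insert t T) where
  two_le := h.two_le.trans hnm
  card_eq s hs := by
    obtain rfl | hs := Finset.mem_insert.1 hs
    exacts [hcard, h.card_eq s hs]
  subset s hs := by
    obtain rfl | hs := Finset.mem_insert.1 hs
    exacts [hsub, (h.subset s hs).trans (Finset.Icc_subset_Icc_right hnm)]
  link_conn x a b ha hb := by
    have key : ∀ c, {x, c} ∈ edgesOf (insert t T) →
        {x, c} ∈ edgesOf T ∨ x ∈ t ∧ c ∈ t ∧ x ≠ c := by
      intro c hc
      have hne := ne_of_pair_mem_edgesOf hc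
      rw [edgesOf_insert, Finset.mem_union, Finset.mem_powersetCard] at hc
      obtain ⟨hc, -⟩ | hc := hc
      · exact Or.inr ⟨hc (by simp), hc (by simp), hne⟩
      · exact Or.inl hc
    have hmono : T ⊆ insert t T := Finset.subset_insert _ _
    have old : ∀ c d, {x, c} ∈ edgesOf T → {x, d} ∈ edgesOf T → LinkPath (insert t T) x c d :=
      fun c d hc hd => (h.link_conn x c d hc hd).mono hmono
    have new : ∀ c d, c ∈ t → d ∈ t → x ∈ t → x ≠ c → x ≠ d → LinkPath (insert t T) x c d := by
      intro c d hc hd hx hxc hxd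
      by_cases hcd : c = d
      · exact hcd ▸ ReflTransGen.refl
      · refine LinkPath.single (Finset.mem_insert.2 (Or.inl ?_))
        refine Finset.eq_of_subset_of_card_le ?_ ?_
        · intro y hy
          simp only [Finset.mem_insert, Finset.mem_singleton] at hy
          obtain rfl | rfl | rfl := hy <;> assumption
        · rw [hcard, Finset.card_eq_three.2 ⟨x, c, d, hxc, hxd, hcd, rfl⟩]
    have mixed : ∀ c d, {x, c} ∈ edgesOf T → d ∈ t → x ∈ t → x ≠ d →
        LinkPath (insert t T) x c d := by
      intro c d hc hd hx hxd
      obtain ⟨e, he⟩ := exists_third hcard hx hd hxd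
      obtain h1 | h1 | h1 := hlink x d e he
      · exact old c d hc h1
      · have hxe := ne_of_pair_mem_edgesOf h1
        exact (old c e hc h1).trans (new e d (by simp [he]) hd hx hxe hxd)
      · exact absurd hc (h1 c)
    obtain ha | ⟨hx, ha, hxa⟩ := key a ha <;> obtain hb | ⟨hx, hb, hxb⟩ := key b hb
    · exact old a b ha hb
    · exact mixed a b ha hb hx hxb
    · exact (mixed b a hb ha hx hxa).symm
    · exact new a b ha hb hx hxa hxb
  conn := by
    have hsym : Std.Symm fun a b => ({a, b} : Finset ℕ) ∈ edgesOf (insert t T) :=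
      ⟨fun a b hab => by rwa [Finset.pair_comm]⟩
    obtain ⟨w, hwt, hw⟩ := hmeet
    have key : ∀ v ∈ Finset.Icc 1 m,
        ReflTransGen (fun a b => ({a, b} : Finset ℕ) ∈ edgesOf (insert t T)) v w := by
      intro v hv
      obtain hv | hv := hcov v hv
      · exact ReflTransGen.mono
          (fun _ _ h => edgesOf_mono (Finset.subset_insert _ _) h) _ _ (h.conn v hv w hw)
      · by_cases hvw : v = w
        · exact hvw ▸ ReflTransGen.refl
        · exact ReflTransGen.single (pair_mem_edgesOf (Finset.mem_insert_self _ _) hv hwt hvw)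
    exact fun u hu v hv => (key u hu).trans (ReflTransGen.stdSymm.symm _ _ (key v hv))

theorem insert_triangle (h : WellLinked n T) {s p q : ℕ} (hsp : {s, p} ∈ edgesOf T)
    (hsq : {s, q} ∈ edgesOf T) (hpq : p ≠ q) : WellLinked n (insert {s, p, q} T) := by
  have hps := hsp
  have hqs := hsq
  rw [Finset.pair_comm] at hps hqs
  have h1 := ne_of_pair_mem_edgesOf hsp
  have h2 := ne_of_pair_mem_edgesOf hsq
  obtain ⟨hs, hp⟩ := h.mem_Icc_of_edge hsp
  obtain ⟨-, hq⟩ := h.mem_Icc_of_edge hsq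
  have hcard := Finset.card_eq_three.2 ⟨s, p, q, h1, h2, hpq, rfl⟩
  refine h.insert_of_link le_rfl hcard ?_ (fun v hv => Or.inl hv) ⟨s, by simp, hs⟩ ?_
  · intro y hy
    simp only [Finset.mem_insert, Finset.mem_singleton] at hy
    obtain rfl | rfl | rfl := hy <;> assumption
  · intro u v w huvw
    obtain ⟨huv, huw, hvw⟩ := ne_of_card_eq_three (huvw ▸ hcard)
    have hu : u ∈ ({s, p, q} : Finset ℕ) := by rw [huvw]; simp
    have hv : v ∈ ({s, p, q} : Finset ℕ) := by rw [huvw]; simp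
    have hw : w ∈ ({s, p, q} : Finset ℕ) := by rw [huvw]; simp
    simp only [Finset.mem_insert, Finset.mem_singleton] at hu hv hw
    obtain rfl | rfl | rfl := hu <;> obtain rfl | rfl | rfl := hv <;>
      obtain rfl | rfl | rfl := hw <;> simp_all

theorem insert_pendant (h : WellLinked n T) {s p : ℕ} (hsp : {s, p} ∈ edgesOf T) :
    WellLinked (n + 1) (insert {n + 1, s, p} T) := by
  have hps := hsp
  rw [Finset.pair_comm] at hps
  have h1 := ne_of_pair_mem_edgesOf hsp
  obtain ⟨hs, hp⟩ := h.mem_Icc_of_edge hsp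
  have hs' := Finset.mem_Icc.1 hs
  have hp' := Finset.mem_Icc.1 hp
  have hcard := Finset.card_eq_three.2 ⟨n + 1, s, p, by omega, by omega, h1, rfl⟩
  refine h.insert_of_link n.le_succ hcard ?_ ?_ ⟨s, by simp, hs⟩ ?_
  · intro y hy
    simp only [Finset.mem_insert, Finset.mem_singleton] at hy
    rw [Finset.mem_Icc]
    omega
  · intro v hv
    rw [Finset.mem_Icc] at hv ⊢
    simp only [Finset.mem_insert]
    omega
  · intro u v w huvw
    obtain ⟨huv, huw, hvw⟩ := ne_of_card_eq_three (huvw ▸ hcard)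
    by_cases hun : u = n + 1
    · refine Or.inr (Or.inr fun a ha => ?_)
      have := Finset.mem_Icc.1 (h.mem_Icc_of_edge ha).1
      omega
    have hu : u ∈ ({n + 1, s, p} : Finset ℕ) := by rw [huvw]; simp
    have hv : v ∈ ({n + 1, s, p} : Finset ℕ) := by rw [huvw]; simp
    have hw : w ∈ ({n + 1, s, p} : Finset ℕ) := by rw [huvw]; simp
    simp only [Finset.mem_insert, Finset.mem_singleton] at hu hv hw
    obtain rfl | rfl | rfl := hu <;> obtain rfl | rfl | rfl := hv <;>
      obtain rfl | rfl | rfl := hw <;> simp_all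

theorem erase_triangle (h : WellLinked n T) {x y z : ℕ} (hxyz : {x, y, z} ∈ T)
    (hx : LinkPath (T.erase {x, y, z}) x y z) (hy : LinkPath (T.erase {x, y, z}) y x z)
    (hz : LinkPath (T.erase {x, y, z}) z x y) :
    WellLinked n (T.erase {x, y, z}) ∧ edgesOf (T.erase {x, y, z}) = edgesOf T := by
  have hcard := h.card_eq _ hxyz
  have key : ∀ u v w, ({u, v, w} : Finset ℕ) = {x, y, z} →
      LinkPath (T.erase {x, y, z}) u v w := by
    intro u v w huvw
    obtain ⟨huv, huw, hvw⟩ := ne_of_card_eq_three (huvw ▸ hcard)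
    have hu : u ∈ ({x, y, z} : Finset ℕ) := by rw [← huvw]; simp
    have hv : v ∈ ({x, y, z} : Finset ℕ) := by rw [← huvw]; simp
    have hw : w ∈ ({x, y, z} : Finset ℕ) := by rw [← huvw]; simp
    simp only [Finset.mem_insert, Finset.mem_singleton] at hu hv hw
    obtain rfl | rfl | rfl := hu <;> obtain rfl | rfl | rfl := hv <;>
      obtain rfl | rfl | rfl := hw <;>
      first
      | exact absurd rfl huv
      | exact absurd rfl huw
      | exact absurd rfl hvw
      | assumption
      | exact LinkPath.symm (by assumption)
  have hpath : ∀ v a b, LinkPath T v a b → LinkPath (T.erase {x, y, z}) v a b := by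
    intro v a b hab
    induction hab with
    | refl => exact ReflTransGen.refl
    | @tail c d _ hcd ih =>
      by_cases he : ({v, c, d} : Finset ℕ) = {x, y, z}
      · exact ih.trans (key v c d he)
      · exact ih.tail (Finset.mem_erase.2 ⟨he, hcd⟩)
  have hedge : edgesOf (T.erase {x, y, z}) = edgesOf T := by
    refine (edgesOf_mono (Finset.erase_subset _ _)).antisymm fun e he => ?_
    obtain ⟨t, ht, hs, h2⟩ := mem_edgesOf.1 he
    by_cases hte : t = {x, y, z}
    · obtain ⟨a, b, hab, rfl⟩ := Finset.card_eq_two.1 h2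
      obtain ⟨c, hc⟩ := exists_third (h.card_eq t ht) (hs (show a ∈ _ by simp))
        (hs (show b ∈ _ by simp)) hab
      obtain ⟨-, -, hbc⟩ := ne_of_card_eq_three (hc ▸ h.card_eq t ht)
      obtain hbc' | ⟨d, hd, -⟩ := ReflTransGen.cases_head (key a b c (hc ▸ hte))
      · exact absurd hbc' hbc
      · exact pair_mem_edgesOf hd (by simp) (by simp) hab
    · exact mem_edgesOf.2 ⟨t, Finset.mem_erase.2 ⟨hte, ht⟩, hs, h2⟩
  refine ⟨⟨h.two_le, fun t ht => h.card_eq t (Finset.mem_of_mem_erase ht),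
    fun t ht => h.subset t (Finset.mem_of_mem_erase ht), ?_, ?_⟩, hedge⟩
  · rw [hedge]
    exact fun v a b ha hb => hpath v a b (h.link_conn v a b ha hb)
  · rw [hedge]
    exact h.conn

end WellLinked

end WellLinkedTriangles

section GeneratedComplex

open Relation

/-- The simplicial complex generated by `T`. -/
def generatedBy (T : Finset (Finset ℕ)) : Finset (Finset ℕ) := T.biUnion Finset.powerset

variable {T : Finset (Finset ℕ)} {n : ℕ}

theorem mem_generatedBy {F : Finset ℕ} : F ∈ generatedBy T ↔ ∃ t ∈ T, F ⊆ t := by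
  simp [generatedBy]

theorem generatedBy_isLowerSet : ∀ F ∈ generatedBy T, ∀ G ⊆ F, G ∈ generatedBy T := by
  intro F hF G hG
  obtain ⟨t, ht, hFt⟩ := mem_generatedBy.1 hF
  exact mem_generatedBy.2 ⟨t, ht, hG.trans hFt⟩

theorem facesOf_two_generatedBy : facesOf (generatedBy T) 2 = edgesOf T := by
  ext e
  simp only [facesOf, Finset.mem_filter, mem_generatedBy, mem_edgesOf]
  exact ⟨fun ⟨⟨t, ht, h⟩, h2⟩ => ⟨t, ht, h, h2⟩, fun ⟨t, ht, h, h2⟩ => ⟨⟨t, ht, h⟩, h2⟩⟩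

theorem pair_mem_generatedBy {a b : ℕ} (hab : a ≠ b) :
    {a, b} ∈ generatedBy T ↔ {a, b} ∈ edgesOf T := by
  rw [← facesOf_two_generatedBy, facesOf, Finset.mem_filter]
  simp [Finset.card_pair hab]

theorem facesOf_three_generatedBy (h : ∀ t ∈ T, t.card = 3) :
    facesOf (generatedBy T) 3 = T := by
  ext F
  simp only [facesOf, Finset.mem_filter, mem_generatedBy]
  constructor
  · rintro ⟨⟨t, ht, hF⟩, h3⟩
    rwa [Finset.eq_of_subset_of_card_le hF (by rw [h t ht, h3])]
  · exact fun hF => ⟨⟨F, hF, Finset.Subset.refl F⟩, h F hF⟩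

namespace WellLinked

theorem singleton_mem_generatedBy (h : WellLinked n T) {v : ℕ} (hv : v ∈ Finset.Icc 1 n) :
    {v} ∈ generatedBy T := by
  obtain ⟨u, hu⟩ := h.exists_edge hv
  obtain ⟨t, ht, hs, -⟩ := mem_edgesOf.1 hu
  exact mem_generatedBy.2 ⟨t, ht, Finset.singleton_subset_iff.2 (hs (by simp))⟩

theorem isComplexOn (h : WellLinked n T) : IsComplexOn n (generatedBy T) := by
  refine ⟨generatedBy_isLowerSet, fun F hF i hi => ?_, fun i hi => h.singleton_mem_generatedBy hi⟩
  obtain ⟨t, ht, hs⟩ := mem_generatedBy.1 hF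
  exact h.subset t ht (hs hi)

theorem mem_Icc_of_singleton (h : WellLinked n T) {v : ℕ} (hv : {v} ∈ generatedBy T) :
    v ∈ Finset.Icc 1 n :=
  h.isComplexOn.2.1 _ hv v (Finset.mem_singleton_self v)

theorem sup_card (h : WellLinked n T) : (generatedBy T).sup Finset.card = 3 := by
  have h2 := h.two_le
  obtain ⟨u, hu⟩ := h.exists_edge (Finset.mem_Icc.2 ⟨le_rfl, by omega⟩)
  obtain ⟨t, ht, -, -⟩ := mem_edgesOf.1 hu
  refine le_antisymm (Finset.sup_le fun F hF => ?_) ?_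
  · obtain ⟨t, ht, hs⟩ := mem_generatedBy.1 hF
    exact (Finset.card_le_card hs).trans (h.card_eq t ht).le
  · rw [← h.card_eq t ht]
    exact Finset.le_sup (mem_generatedBy.2 ⟨t, ht, Finset.Subset.refl t⟩)

theorem dimZ_eq (h : WellLinked n T) : dimZ (generatedBy T) = 2 := by
  rw [dimZ, h.sup_card]
  norm_num

theorem isConnectedComplex (h : WellLinked n T) : IsConnectedComplex (generatedBy T) := by
  intro u v hu hv
  refine ReflTransGen.mono (fun a b hab => ?_) _ _
    (h.conn u (h.mem_Icc_of_singleton hu) v (h.mem_Icc_of_singleton hv))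
  have hne := ne_of_pair_mem_edgesOf hab
  exact ⟨hne, (pair_mem_generatedBy hne).2 hab⟩

theorem isPure (h : WellLinked n T) : IsPure (generatedBy T) := by
  intro F hF hmax
  obtain ⟨t, ht, hs⟩ := mem_generatedBy.1 hF
  rw [hmax t (mem_generatedBy.2 ⟨t, ht, Finset.Subset.refl t⟩) hs, h.sup_card, h.card_eq t ht]

theorem singleton_mem_link {v a : ℕ} :
    {a} ∈ link (generatedBy T) {v} ↔ {v, a} ∈ edgesOf T := by
  rw [mem_link_singleton generatedBy_isLowerSet, Finset.mem_singleton]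
  constructor
  · rintro ⟨hne, hmem⟩
    exact (pair_mem_generatedBy hne).1 hmem
  · intro hmem
    have hne := ne_of_pair_mem_edgesOf hmem
    exact ⟨hne, (pair_mem_generatedBy hne).2 hmem⟩

theorem isConnectedComplex_link (h : WellLinked n T) (v : ℕ) :
    IsConnectedComplex (link (generatedBy T) {v}) := by
  intro a b ha hb
  rw [singleton_mem_link] at ha hb
  refine ReflTransGen.mono (fun c d hcd => ?_) _ _ (h.link_conn v a b ha hb)
  obtain ⟨hvc, hvd, hcd'⟩ := ne_of_card_eq_three (h.card_eq _ hcd)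
  refine ⟨hcd', (mem_link_singleton generatedBy_isLowerSet).2 ⟨?_, ?_⟩⟩
  · simp [hvc, hvd]
  · exact mem_generatedBy.2 ⟨_, hcd, Finset.Subset.refl _⟩

theorem card_le_two_of_mem_link (h : WellLinked n T) {v : ℕ} {F : Finset ℕ}
    (hF : F ∈ link (generatedBy T) {v}) : F.card ≤ 2 := by
  obtain ⟨hv, hF⟩ := (mem_link_singleton generatedBy_isLowerSet).1 hF
  obtain ⟨t, ht, hs⟩ := mem_generatedBy.1 hF
  have := Finset.card_le_card hs
  rw [Finset.card_insert_of_notMem hv, h.card_eq t ht] at this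
  omega

theorem exists_pair_mem_link (h : WellLinked n T) {v a : ℕ}
    (ha : {a} ∈ link (generatedBy T) {v}) :
    ∃ b, a ≠ b ∧ {a, b} ∈ link (generatedBy T) {v} := by
  rw [singleton_mem_link] at ha
  have hva := ne_of_pair_mem_edgesOf ha
  obtain ⟨t, ht, hs, -⟩ := mem_edgesOf.1 ha
  obtain ⟨b, rfl⟩ := exists_third (h.card_eq t ht) (hs (show v ∈ _ by simp))
    (hs (show a ∈ _ by simp)) hva
  obtain ⟨-, hvb, hab⟩ := ne_of_card_eq_three (h.card_eq _ ht)
  refine ⟨b, hab, (mem_link_singleton generatedBy_isLowerSet).2 ⟨?_, ?_⟩⟩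
  · simp [hva, hvb]
  · exact mem_generatedBy.2 ⟨_, ht, Finset.Subset.refl _⟩

theorem dimZ_link (h : WellLinked n T) {v : ℕ} (hv : {v} ∈ generatedBy T) :
    dimZ (link (generatedBy T) {v}) = 1 := by
  obtain ⟨u, hu⟩ := h.exists_edge (h.mem_Icc_of_singleton hv)
  obtain ⟨b, hub, hb⟩ := h.exists_pair_mem_link (singleton_mem_link.2 hu)
  have : (link (generatedBy T) {v}).sup Finset.card = 2 := by
    refine le_antisymm (Finset.sup_le fun F hF => h.card_le_two_of_mem_link hF) ?_
    rw [← Finset.card_pair hub]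
    exact Finset.le_sup hb
  rw [dimZ, this]
  norm_num

theorem isCohenMacaulay_link (K : Type) [Field K] (h : WellLinked n T) {v : ℕ}
    (hv : {v} ∈ generatedBy T) : IsCohenMacaulay K (link (generatedBy T) {v}) := by
  intro F hF i hi
  rw [h.dimZ_link hv] at hi
  rw [betti]
  split_ifs with h0
  swap
  · rfl
  obtain ⟨m, hm⟩ := Int.eq_ofNat_of_zero_le h0
  rw [hm, Int.toNat_natCast]
  have hne : m + F.card ≠ 2 := by omega
  by_cases hgt : 2 < m + F.card
  · refine homDim_eq_zero_of_forall_card_ne K fun G hG hGm => ?_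
    obtain ⟨-, hdisj, hGF⟩ := Finset.mem_filter.1 hG
    have := h.card_le_two_of_mem_link hGF
    rw [Finset.card_union_of_disjoint hdisj] at this
    omega
  obtain ⟨u, hu⟩ := h.exists_edge (h.mem_Icc_of_singleton hv)
  obtain hF0 | hF1 : F.card = 0 ∨ F.card = 1 := by omega
  · obtain rfl := Finset.card_eq_zero.1 hF0
    rw [link_empty]
    obtain rfl | rfl : m = 0 ∨ m = 1 := by omega
    · exact homDim_zero_eq_zero K (singleton_mem_link.2 hu)
    · exact homDim_one_eq_zero K (h.isConnectedComplex_link v)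
  · obtain ⟨a, rfl⟩ := Finset.card_eq_one.1 hF1
    obtain rfl : m = 0 := by omega
    obtain ⟨b, hab, hmem⟩ := h.exists_pair_mem_link hF
    refine homDim_zero_eq_zero K (v := b) ?_
    rw [mem_link_singleton (link_isLowerSet generatedBy_isLowerSet v)]
    exact ⟨by simpa using hab, hmem⟩

theorem isBuchsbaum (K : Type) [Field K] (h : WellLinked n T) :
    IsBuchsbaum K (generatedBy T) :=
  ⟨h.isPure, fun _ hv => h.isCohenMacaulay_link K hv⟩

end WellLinked

end GeneratedComplex

section Sandwich

open Relation

/-- There are a smallest and a largest set of triangles on `[n]` with the same `2n - 3 + a` edges: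
the smallest has all vertex links connected and is as small as these edges permit, while the
largest attains the Macaulay bound. -/
def HasSandwich (n a : ℕ) : Prop :=
  ∃ T H : Finset (Finset ℕ), WellLinked n T ∧ T ⊆ H ∧ (∀ t ∈ H, t.card = 3) ∧
    edgesOf H ⊆ edgesOf T ∧ (edgesOf T).card + 3 = 2 * n + a ∧
    3 * T.card + n ≤ 2 * (edgesOf T).card + 2 ∧ H.card + 2 = n + a + macaulay2 a

/-- A set of triangles on `[j + 1]` whose edges are all pairs in `[j]` and the pairs joining `j + 1`
to a member of `N`; `excess` compares the number of triangles to the minimum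
`(2 * #edges - #vertices) / 3`. -/
structure PartialCone (j : ℕ) (N : Finset ℕ) (T : Finset (Finset ℕ)) (excess : ℕ) : Prop where
  wellLinked : WellLinked (j + 1) T
  subset : N ⊆ Finset.Icc 1 j
  edges : edgesOf T =
    Finset.powersetCard 2 (Finset.Icc 1 j) ∪ N.image fun u => {j + 1, u}
  card_eq : 3 * T.card + (j + 1) = 2 * (j.choose 2 + N.card) + excess

/-- A set of triangles on `[j]` whose edges are all pairs in `[j]`. -/
structure CompleteEdges (j : ℕ) (T : Finset (Finset ℕ)) (excess : ℕ) : Prop where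
  wellLinked : WellLinked j T
  edges : edgesOf T = Finset.powersetCard 2 (Finset.Icc 1 j)
  card_eq : 3 * T.card + j = 2 * j.choose 2 + excess

variable {T : Finset (Finset ℕ)} {N : Finset ℕ} {n j a σ : ℕ}

theorem powersetCard_two_triple {x y z : ℕ} (hxy : x ≠ y) (hxz : x ≠ z) (hyz : y ≠ z) :
    Finset.powersetCard 2 {x, y, z} = {{x, y}, {x, z}, {y, z}} := by
  have hcard := Finset.card_eq_three.2 ⟨x, y, z, hxy, hxz, hyz, rfl⟩
  ext e
  simp only [Finset.mem_powersetCard, Finset.mem_insert, Finset.mem_singleton]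
  constructor
  · rintro ⟨hs, h2⟩
    obtain ⟨a, b, hab, rfl⟩ := Finset.card_eq_two.1 h2
    have ha := hs (show a ∈ _ by simp)
    have hb := hs (show b ∈ _ by simp)
    simp only [Finset.mem_insert, Finset.mem_singleton] at ha hb
    obtain rfl | rfl | rfl := ha <;> obtain rfl | rfl | rfl := hb <;>
      simp_all [Finset.pair_comm]
  · rintro (rfl | rfl | rfl)
    · exact ⟨by intro; simp; tauto, Finset.card_pair hxy⟩
    · exact ⟨by intro; simp; tauto, Finset.card_pair hxz⟩
    · exact ⟨by intro; simp; tauto, Finset.card_pair hyz⟩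

theorem pair_mem_powersetCard_Icc {u v : ℕ} (hu : u ∈ Finset.Icc 1 j) (hv : v ∈ Finset.Icc 1 j)
    (huv : u ≠ v) : {u, v} ∈ Finset.powersetCard 2 (Finset.Icc 1 j) :=
  Finset.mem_powersetCard.2
    ⟨Finset.insert_subset hu (Finset.singleton_subset_iff.2 hv), Finset.card_pair huv⟩

theorem HasSandwich.succ (h : HasSandwich n a) : HasSandwich (n + 1) a := by
  obtain ⟨T, H, hT, hTH, hH, hedges, hE, hcard, hHcard⟩ := h
  have h2 := hT.two_le
  obtain ⟨p, hsp⟩ := hT.exists_edge (Finset.mem_Icc.2 ⟨le_rfl, by omega⟩)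
  obtain ⟨hs, hp⟩ := hT.mem_Icc_of_edge hsp
  have hne := ne_of_pair_mem_edgesOf hsp
  rw [Finset.mem_Icc] at hs hp
  have hnot : ∀ e ∈ edgesOf T, n + 1 ∉ e := by
    intro e he hmem
    obtain ⟨t, ht, hs, -⟩ := mem_edgesOf.1 he
    have := Finset.mem_Icc.1 (hT.subset t ht (hs hmem))
    omega
  have hnotH : ({n + 1, 1, p} : Finset ℕ) ∉ H := by
    intro hmem
    refine hnot _ (hedges (pair_mem_edgesOf hmem (a := n + 1) (b := 1) ?_ ?_ ?_)) ?_
    · simp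
    · simp
    · omega
    · simp
  have hedges' : edgesOf (insert {n + 1, 1, p} T) =
      insert {n + 1, 1} (insert {n + 1, p} (edgesOf T)) := by
    rw [edgesOf_insert, powersetCard_two_triple (by omega) (by omega) hne]
    ext e
    simp only [Finset.mem_union, Finset.mem_insert, Finset.mem_singleton]
    constructor
    · rintro ((h | h | rfl) | h)
      exacts [Or.inl h, Or.inr (Or.inl h), Or.inr (Or.inr hsp), Or.inr (Or.inr h)]
    · rintro (h | h | h) <;> simp [h]
  have hE' : (edgesOf (insert {n + 1, 1, p} T)).card = (edgesOf T).card + 2 := by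
    rw [hedges', Finset.card_insert_of_notMem, Finset.card_insert_of_notMem]
    · exact fun hmem => hnot _ hmem (by simp)
    · rw [Finset.mem_insert]
      rintro (heq | hmem)
      · have : 1 ∈ ({n + 1, p} : Finset ℕ) := by rw [← heq]; simp
        simp only [Finset.mem_insert, Finset.mem_singleton] at this
        omega
      · exact hnot _ hmem (by simp)
  refine ⟨insert {n + 1, 1, p} T, insert {n + 1, 1, p} H, hT.insert_pendant hsp,
    Finset.insert_subset_insert _ hTH, ?_, ?_, ?_, ?_, ?_⟩
  · intro t ht
    obtain rfl | ht := Finset.mem_insert.1 ht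
    · exact Finset.card_eq_three.2 ⟨n + 1, 1, p, by omega, by omega, hne, rfl⟩
    · exact hH t ht
  · rw [edgesOf_insert, edgesOf_insert]
    exact Finset.union_subset_union_right hedges
  · omega
  · rw [hE', Finset.card_insert_of_notMem fun hmem => hnotH (hTH hmem)]
    omega
  · rw [Finset.card_insert_of_notMem hnotH]
    omega

theorem HasSandwich.mono {m : ℕ} (h : HasSandwich n a) (hnm : n ≤ m) : HasSandwich m a := by
  induction m, hnm using Nat.le_induction with
  | base => exact h
  | succ m _ ih => exact ih.succ

theorem CompleteEdges.pair_mem (h : CompleteEdges j T σ) {u v : ℕ} (hu : u ∈ Finset.Icc 1 j)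
    (hv : v ∈ Finset.Icc 1 j) (huv : u ≠ v) : {u, v} ∈ edgesOf T := by
  rw [h.edges]
  exact pair_mem_powersetCard_Icc hu hv huv

theorem CompleteEdges.cone (h : CompleteEdges j T σ) {u v : ℕ} (hu : u ∈ Finset.Icc 1 j)
    (hv : v ∈ Finset.Icc 1 j) (huv : u ≠ v) :
    PartialCone j {u, v} (insert {j + 1, u, v} T) σ := by
  have huv' := h.pair_mem hu hv huv
  have hu' := Finset.mem_Icc.1 hu
  have hv' := Finset.mem_Icc.1 hv
  refine ⟨h.wellLinked.insert_pendant huv', ?_, ?_, ?_⟩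
  · exact Finset.insert_subset hu (Finset.singleton_subset_iff.2 hv)
  · rw [edgesOf_insert, powersetCard_two_triple (by omega) (by omega) huv, h.edges]
    rw [h.edges] at huv'
    ext e
    simp only [Finset.mem_union, Finset.mem_insert, Finset.mem_singleton, Finset.image_insert,
      Finset.image_singleton]
    constructor
    · rintro ((h | h | rfl) | h)
      exacts [Or.inr (Or.inl h), Or.inr (Or.inr h), Or.inl huv', Or.inl h]
    · rintro (h | h | h) <;> simp [h]
  · rw [Finset.card_insert_of_notMem, Finset.card_pair huv]
    · have := h.card_eq
      omega
    · intro hmem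
      have := Finset.mem_Icc.1 (h.wellLinked.subset _ hmem (Finset.mem_insert_self _ _))
      omega

namespace PartialCone

theorem pair_mem (h : PartialCone j N T σ) {u v : ℕ} (hu : u ∈ Finset.Icc 1 j)
    (hv : v ∈ Finset.Icc 1 j) (huv : u ≠ v) : {u, v} ∈ edgesOf T := by
  rw [h.edges]
  exact Finset.mem_union_left _ (pair_mem_powersetCard_Icc hu hv huv)

theorem apex_pair_mem_iff (h : PartialCone j N T σ) {u : ℕ} :
    {j + 1, u} ∈ edgesOf T ↔ u ∈ N := by
  rw [h.edges, Finset.mem_union, Finset.mem_image]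
  constructor
  · rintro (h1 | ⟨v, hv, heq⟩)
    · have := Finset.mem_Icc.1 ((Finset.mem_powersetCard.1 h1).1 (Finset.mem_insert_self _ _))
      omega
    · have hvu : v ∈ ({j + 1, u} : Finset ℕ) := by rw [← heq]; simp
      have hvj := Finset.mem_Icc.1 (h.subset hv)
      simp only [Finset.mem_insert, Finset.mem_singleton] at hvu
      obtain rfl : v = u := by omega
      exact hv
  · exact fun hu => Or.inr ⟨u, hu, rfl⟩

theorem insert_neighbor (h : PartialCone j N T σ) {u v : ℕ} (hu : u ∈ N)
    (hv : v ∈ Finset.Icc 1 j) (hvN : v ∉ N) :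
    PartialCone j (insert v N) (insert {u, j + 1, v} T) (σ + 1) := by
  have huv : u ≠ v := fun heq => hvN (heq ▸ hu)
  have huj := h.subset hu
  have hu' := Finset.mem_Icc.1 huj
  have hv' := Finset.mem_Icc.1 hv
  have huv' := h.pair_mem huj hv huv
  have huw := h.apex_pair_mem_iff.2 hu
  rw [Finset.pair_comm] at huw
  refine ⟨h.wellLinked.insert_triangle huw huv' (by omega), Finset.insert_subset hv h.subset,
    ?_, ?_⟩
  · rw [edgesOf_insert, powersetCard_two_triple (by omega) huv (by omega)]
    rw [h.edges] at *
    ext e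
    simp only [Finset.image_insert, Finset.mem_union, Finset.mem_insert, Finset.mem_singleton] at *
    constructor
    · rintro ((rfl | rfl | h) | h | h)
      · tauto
      · tauto
      · tauto
      · tauto
      · tauto
    · rintro (h | h | h) <;> tauto
  · rw [Finset.card_insert_of_notMem, Finset.card_insert_of_notMem hvN]
    · have := h.card_eq
      omega
    · intro hmem
      refine hvN (h.apex_pair_mem_iff.1 (pair_mem_edgesOf hmem ?_ ?_ ?_))
      · simp
      · simp
      · omega

theorem erase_triangle {x y z : ℕ} (h : PartialCone j N T (σ + 3)) (hxyz : {x, y, z} ∈ T)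
    (hx : LinkPath (T.erase {x, y, z}) x y z) (hy : LinkPath (T.erase {x, y, z}) y x z)
    (hz : LinkPath (T.erase {x, y, z}) z x y) :
    PartialCone j N (T.erase {x, y, z}) σ := by
  obtain ⟨h1, h2⟩ := h.wellLinked.erase_triangle hxyz hx hy hz
  refine ⟨h1, h.subset, h2.trans h.edges, ?_⟩
  have := h.card_eq
  have := Finset.card_erase_add_one hxyz
  omega

theorem complete (h : PartialCone j (Finset.Icc 1 j) T σ) : CompleteEdges (j + 1) T σ := by
  refine ⟨h.wellLinked, ?_, ?_⟩
  · ext e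
    constructor
    · intro he
      obtain ⟨t, ht, hs, h2⟩ := mem_edgesOf.1 he
      exact Finset.mem_powersetCard.2 ⟨hs.trans (h.wellLinked.subset t ht), h2⟩
    · intro he
      obtain ⟨hs, h2⟩ := Finset.mem_powersetCard.1 he
      obtain ⟨a, b, hab, rfl⟩ := Finset.card_eq_two.1 h2
      have ha := Finset.mem_Icc.1 (hs (show a ∈ _ by simp))
      have hb := Finset.mem_Icc.1 (hs (show b ∈ _ by simp))
      by_cases haj : a = j + 1
      · rw [haj]
        exact h.apex_pair_mem_iff.2 (Finset.mem_Icc.2 ⟨hb.1, by omega⟩)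
      · by_cases hbj : b = j + 1
        · rw [hbj, Finset.pair_comm]
          exact h.apex_pair_mem_iff.2 (Finset.mem_Icc.2 ⟨ha.1, by omega⟩)
        · exact h.pair_mem (Finset.mem_Icc.2 ⟨ha.1, by omega⟩)
            (Finset.mem_Icc.2 ⟨hb.1, by omega⟩) hab
  · have := h.card_eq
    rw [Nat.card_Icc] at this
    have := succ_choose_two j
    omega

theorem card_edgesOf (h : PartialCone j N T σ) :
    (edgesOf T).card = j.choose 2 + N.card := by
  rw [h.edges, Finset.card_union_of_disjoint, Finset.card_powersetCard, Nat.card_Icc,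
    Finset.card_image_of_injOn]
  · simp
  · intro u hu v hv huv
    have := Finset.mem_Icc.1 (h.subset hu)
    have hmem : u ∈ ({j + 1, v} : Finset ℕ) := by
      rw [← show ({j + 1, u} : Finset ℕ) = {j + 1, v} from huv]
      simp
    simp only [Finset.mem_insert, Finset.mem_singleton] at hmem
    omega
  · rw [Finset.disjoint_left]
    intro e he he'
    obtain ⟨u, -, rfl⟩ := Finset.mem_image.1 he'
    have := Finset.mem_Icc.1 ((Finset.mem_powersetCard.1 he).1 (Finset.mem_insert_self _ _))
    omega

theorem hasSandwich (h : PartialCone j N T σ) (hσ : σ ≤ 2) (hN : 2 ≤ N.card) :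
    HasSandwich (j + 1) ((j - 2).choose 2 + (N.card - 2)) := by
  have hNj := Finset.card_le_card h.subset
  rw [Nat.card_Icc] at hNj
  obtain ⟨b, rfl⟩ : ∃ b, j = b + 2 := ⟨j - 2, by omega⟩
  obtain ⟨r, hr⟩ : ∃ r, N.card = r + 2 := ⟨N.card - 2, by omega⟩
  have hE := h.card_edgesOf
  have hcard := h.card_eq
  have hnot : ∀ f ∈ Finset.powersetCard 2 N, b + 2 + 1 ∉ f := fun f hf hmem => by
    have := Finset.mem_Icc.1 (h.subset ((Finset.mem_powersetCard.1 hf).1 hmem))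
    omega
  set H := Finset.powersetCard 3 (Finset.Icc 1 (b + 2)) ∪
    (Finset.powersetCard 2 N).image (insert (b + 2 + 1)) with hH
  have hHcard : H.card = (b + 2).choose 3 + (r + 2).choose 2 := by
    rw [hH, Finset.card_union_of_disjoint, Finset.card_powersetCard, Finset.card_image_of_injOn,
      Finset.card_powersetCard, Nat.card_Icc, hr]
    · simp
    · intro f hf g hg hfg
      rw [← Finset.erase_insert (hnot f hf), ← Finset.erase_insert (hnot g hg)]
      exact congrArg (fun s => Finset.erase s (b + 2 + 1)) hfg
    · rw [Finset.disjoint_left]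
      intro e he he'
      obtain ⟨f, -, rfl⟩ := Finset.mem_image.1 he'
      have := Finset.mem_Icc.1 ((Finset.mem_powersetCard.1 he).1 (Finset.mem_insert_self _ _))
      omega
  have hH3 : ∀ t ∈ H, t.card = 3 := by
    intro t ht
    rw [hH, Finset.mem_union, Finset.mem_image] at ht
    obtain ht | ⟨f, hf, rfl⟩ := ht
    · exact (Finset.mem_powersetCard.1 ht).2
    · rw [Finset.card_insert_of_notMem (hnot f hf), (Finset.mem_powersetCard.1 hf).2]
  refine ⟨T, H, h.wellLinked, ?_, hH3, ?_, ?_, ?_, ?_⟩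
  · intro t ht
    have ht3 := h.wellLinked.card_eq t ht
    rw [hH, Finset.mem_union, Finset.mem_image]
    by_cases hmem : b + 2 + 1 ∈ t
    · refine Or.inr ⟨t.erase (b + 2 + 1), Finset.mem_powersetCard.2 ⟨fun u hu => ?_, ?_⟩,
        Finset.insert_erase hmem⟩
      · obtain ⟨hne, hut⟩ := Finset.mem_erase.1 hu
        exact h.apex_pair_mem_iff.1 (pair_mem_edgesOf ht hmem hut hne.symm)
      · rw [Finset.card_erase_of_mem hmem, ht3]
    · refine Or.inl (Finset.mem_powersetCard.2 ⟨fun u hu => ?_, ht3⟩)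
      have := Finset.mem_Icc.1 (h.wellLinked.subset t ht hu)
      have hne : u ≠ b + 2 + 1 := fun heq => hmem (heq ▸ hu)
      exact Finset.mem_Icc.2 ⟨this.1, by omega⟩
  · intro e he
    obtain ⟨t, ht, hs, h2⟩ := mem_edgesOf.1 he
    obtain ⟨x, y, hxy, rfl⟩ := Finset.card_eq_two.1 h2
    have hx := hs (show x ∈ _ by simp)
    have hy := hs (show y ∈ _ by simp)
    rw [hH, Finset.mem_union, Finset.mem_image] at ht
    obtain ht | ⟨f, hf, rfl⟩ := ht
    · have hsub := (Finset.mem_powersetCard.1 ht).1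
      exact h.pair_mem (hsub hx) (hsub hy) hxy
    · have hsub := (Finset.mem_powersetCard.1 hf).1
      obtain rfl | hx := Finset.mem_insert.1 hx
      · obtain rfl | hy := Finset.mem_insert.1 hy
        · exact absurd rfl hxy
        · exact h.apex_pair_mem_iff.2 (hsub hy)
      · obtain rfl | hy := Finset.mem_insert.1 hy
        · rw [Finset.pair_comm]
          exact h.apex_pair_mem_iff.2 (hsub hx)
        · exact h.pair_mem (h.subset (hsub hx)) (h.subset (hsub hy)) hxy
  · have c1 : (b + 2).choose 2 = (b + 1).choose 2 + (b + 1) := succ_choose_two (b + 1)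
    have c2 := succ_choose_two b
    rw [hE, hr, c1, c2]
    simp only [Nat.add_sub_cancel]
    omega
  · omega
  · have hm : macaulay2 (b.choose 2 + r) = _ := macaulay2_eq (by omega : r ≤ b)
    have c1 : (b + 2).choose 3 = (b + 1).choose 3 + (b + 1).choose 2 := succ_choose_three (b + 1)
    have c2 := succ_choose_two b
    have c3 : (r + 2).choose 2 = (r + 1).choose 2 + (r + 1) := succ_choose_two (r + 1)
    rw [hHcard, hr, c1, c2, c3]
    simp only [Nat.add_sub_cancel]
    rw [hm]
    omega

end PartialCone

end Sandwich

section Legs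

open Relation

/-- One of the two vertices `3 * c + 2`, `3 * c + 3`, chosen according to the parity of `j + c`. -/
def near (j c : ℕ) : ℕ := if (j + c) % 2 = 1 then 3 * c + 2 else 3 * c + 3

/-- The link of `x + 1` contains the path `x, near (x + 1) c, 3 * c + 1, near (x + 2) c`. -/
def HasLeg (T : Finset (Finset ℕ)) (x c : ℕ) : Prop :=
  {x + 1, x, near (x + 1) c} ∈ T ∧ {x + 1, near (x + 1) c, 3 * c + 1} ∈ T ∧
    {x + 1, 3 * c + 1, near (x + 2) c} ∈ T

variable {T P : Finset (Finset ℕ)} {N : Finset ℕ}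

theorem near_cases (x c : ℕ) :
    near (x + 1) c = 3 * c + 2 ∧ near (x + 2) c = 3 * c + 3 ∧ near (x + 3) c = 3 * c + 2 ∨
    near (x + 1) c = 3 * c + 3 ∧ near (x + 2) c = 3 * c + 2 ∧ near (x + 3) c = 3 * c + 3 := by
  unfold near
  rcases Nat.mod_two_eq_zero_or_one (x + c) with h | h
  · left
    refine ⟨if_pos (by omega), if_neg (by omega), if_pos (by omega)⟩
  · right
    refine ⟨if_neg (by omega), if_pos (by omega), if_neg (by omega)⟩

theorem mem_erase_of_notMem {t R : Finset ℕ} (ht : t ∈ T) {a : ℕ} (ha : a ∈ t) (haR : a ∉ R) :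
    t ∈ T.erase R :=
  Finset.mem_erase.2 ⟨fun h => haR (h ▸ ha), ht⟩

theorem HasLeg.mono {S : Finset (Finset ℕ)} {x c : ℕ} (h : HasLeg T x c) (hTS : T ⊆ S) :
    HasLeg S x c :=
  ⟨hTS h.1, hTS h.2.1, hTS h.2.2⟩

theorem HasLeg.erase {x c : ℕ} (h : HasLeg T x c) {R : Finset ℕ} (hR : x + 1 ∉ R) :
    HasLeg (T.erase R) x c :=
  ⟨mem_erase_of_notMem h.1 (by simp) hR, mem_erase_of_notMem h.2.1 (by simp) hR,
    mem_erase_of_notMem h.2.2 (by simp) hR⟩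

theorem triple_rotate (a b c : ℕ) : ({a, b, c} : Finset ℕ) = {b, c, a} := by
  ext; simp; tauto

theorem triple_swap (a b c : ℕ) : ({a, b, c} : Finset ℕ) = {b, a, c} :=
  Finset.insert_comm a b {c}

theorem PartialCone.extend_leg {x k C : ℕ} (h : PartialCone (x + 1) N T 0) (hw : x + 1 ∈ N)
    (hC : 3 * C < x) (hN : ∀ y ∈ N, y ≤ 3 * k ∨ 3 * k + 3 < y)
    (hlegs : ∀ c, k ≤ c → c < C → HasLeg T x c) (hkC : k < C)
    (hlegs' : ∀ c < k, HasLeg T (x + 1) c) (hPT : P ⊆ T)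
    (hP : ∀ t ∈ P, ∃ y ∈ t, 3 * k + 3 < y ∧ y ≠ x + 1) (hpath : LinkPath P (x + 1) x (x + 2)) :
    (∃ T', PartialCone (x + 1) (insert (3 * k + 1) (insert (3 * k + 2) (insert (3 * k + 3) N))) T' 0
      ∧ (∀ c, k + 1 ≤ c → c < C → HasLeg T' x c) ∧ (∀ c < k + 1, HasLeg T' (x + 1) c) ∧ P ⊆ T') ∧
    (∃ N' T' σ, N'.card = N.card + 1 ∧ σ ≤ 2 ∧ PartialCone (x + 1) N' T' σ) ∧
    (∃ N' T' σ, N'.card = N.card + 2 ∧ σ ≤ 2 ∧ PartialCone (x + 1) N' T' σ) := by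
  have hleg := hlegs k le_rfl hkC
  have hnear := near_cases x k
  obtain ⟨l1, l2, l3⟩ := hleg
  have hlegx : HasLeg T x k := ⟨l1, l2, l3⟩
  obtain ⟨y, hy⟩ : ∃ y, y = near (x + 1) k := ⟨_, rfl⟩
  obtain ⟨s, hs⟩ : ∃ s, s = near (x + 2) k := ⟨_, rfl⟩
  have hy3 : near (x + 3) k = y := by omega
  rw [← hy] at l1 l2
  rw [← hs] at l3
  rw [← hy, ← hs, hy3] at hnear
  have hsN : s ∉ N := fun h => by have := hN s h; omega
  have hzN : 3 * k + 1 ∉ insert s N := fun h => by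
    obtain h | h := Finset.mem_insert.1 h
    · omega
    · have := hN _ h; omega
  have hyN : y ∉ insert (3 * k + 1) (insert s N) := fun h => by
    obtain h | h := Finset.mem_insert.1 h
    · omega
    · obtain h | h := Finset.mem_insert.1 h
      · omega
      · have := hN _ h; omega
  have h1 := h.insert_neighbor hw (v := s) (Finset.mem_Icc.2 (by omega)) hsN
  have h2 := h1.insert_neighbor (Finset.mem_insert_self s N) (v := 3 * k + 1)
    (Finset.mem_Icc.2 (by omega)) hzN
  have h3 := h2.insert_neighbor (Finset.mem_insert_self _ _) (v := y)
    (Finset.mem_Icc.2 (by omega)) hyN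
  refine ⟨?_, ⟨_, _, _, Finset.card_insert_of_notMem hsN, by omega, h1⟩,
    ⟨_, _, _, ?_, by omega, h2⟩⟩
  swap
  · rw [Finset.card_insert_of_notMem hzN, Finset.card_insert_of_notMem hsN]
  set U := insert {3 * k + 1, x + 1 + 1, y} (insert {s, x + 1 + 1, 3 * k + 1}
    (insert {x + 1, x + 1 + 1, s} T)) with hU
  have hTU : T ⊆ U := by
    intro t ht
    simp [hU, ht]
  set R : Finset ℕ := {x + 1, 3 * k + 1, s} with hR
  have hRU : R ∈ U := hTU l3
  have hnotR : ∀ v, v ≠ x + 1 → v ≠ 3 * k + 1 → v ≠ s → v ∉ R := by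
    intro v hv1 hv2 hv3
    simp [hR, hv1, hv2, hv3]
  have xR := hnotR x (by omega) (by omega) (by omega)
  have yR := hnotR y (by omega) (by omega) (by omega)
  have vR := hnotR (x + 2) (by omega) (by omega) (by omega)
  have m1 : ({x + 1, x, y} : Finset ℕ) ∈ U.erase R :=
    mem_erase_of_notMem (hTU l1) (a := x) (by simp) xR
  have m2 : ({x + 1, y, 3 * k + 1} : Finset ℕ) ∈ U.erase R :=
    mem_erase_of_notMem (hTU l2) (a := y) (by simp) yR
  have m3 : ({x + 1, x + 2, s} : Finset ℕ) ∈ U.erase R :=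
    mem_erase_of_notMem (a := x + 2) (by simp [hU]) (by simp) vR
  have m4 : ({s, x + 2, 3 * k + 1} : Finset ℕ) ∈ U.erase R :=
    mem_erase_of_notMem (a := x + 2) (by simp [hU]) (by simp) vR
  have m5 : ({3 * k + 1, x + 2, y} : Finset ℕ) ∈ U.erase R :=
    mem_erase_of_notMem (a := x + 2) (by simp [hU]) (by simp) vR
  have hPU : P ⊆ U.erase R := by
    intro t ht
    obtain ⟨v, hv, h1, h2⟩ := hP t ht
    exact mem_erase_of_notMem (hTU (hPT ht)) hv (hnotR v h2 (by omega) (by omega))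
  have p1 : LinkPath (U.erase R) (x + 1) (3 * k + 1) s := by
    refine (LinkPath.single (b := y) ?_).trans ((LinkPath.single (b := x) ?_).trans
      ((hpath.mono hPU).trans (LinkPath.single m3)))
    · rwa [Finset.pair_comm]
    · rwa [Finset.pair_comm]
  have p2 : LinkPath (U.erase R) (3 * k + 1) (x + 1) s := by
    refine (LinkPath.single (b := y) ?_).trans ((LinkPath.single (b := x + 2) ?_).trans
      (LinkPath.single ?_))
    · rwa [triple_rotate]
    · rwa [Finset.pair_comm]
    · rwa [triple_rotate, triple_swap] at m4
  have p3 : LinkPath (U.erase R) s (x + 1) (3 * k + 1) := by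
    refine (LinkPath.single (b := x + 2) ?_).trans (LinkPath.single m4)
    rwa [triple_rotate]
  have h4 := h3.erase_triangle (σ := 0) hRU p1 p2 p3
  refine ⟨U.erase R, ?_, ?_, ?_, hPU⟩
  · convert h4 using 1
    ext v
    simp only [Finset.mem_insert]
    obtain ⟨e1, e2, -⟩ | ⟨e1, e2, -⟩ := hnear <;> rw [e1, e2] <;> tauto
  · intro c hc hcC
    obtain ⟨g1, g2, g3⟩ := hlegs c (by omega) hcC
    have hcR : 3 * c + 1 ∉ R := hnotR _ (by omega) (by omega) (by omega)
    exact ⟨mem_erase_of_notMem (hTU g1) (a := x) (by simp) xR,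
      mem_erase_of_notMem (hTU g2) (a := 3 * c + 1) (by simp) hcR,
      mem_erase_of_notMem (hTU g3) (a := 3 * c + 1) (by simp) hcR⟩
  · intro c hc
    obtain hc | rfl := Nat.lt_succ_iff_lt_or_eq.1 hc
    · exact ((hlegs' c hc).mono hTU).erase vR
    · refine ⟨?_, ?_, ?_⟩
      · rw [show near (x + 1 + 1) c = s from hs.symm, triple_swap]
        exact m3
      · rw [show near (x + 1 + 1) c = s from hs.symm, triple_swap]
        exact m4
      · rw [show near (x + 1 + 2) c = y from hy3, triple_swap]
        exact m5

theorem PartialCone.extend_legs {x C : ℕ} (h : PartialCone (x + 1) N T 0) (hw : x + 1 ∈ N)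
    (hC : 3 * C < x) (hN : ∀ y ∈ N, 3 * C < y)
    (hlegs : ∀ c < C, HasLeg T x c) (hPT : P ⊆ T)
    (hP : ∀ t ∈ P, ∃ y ∈ t, 3 * C < y ∧ y ≠ x + 1) (hpath : LinkPath P (x + 1) x (x + 2)) :
    (∃ T', PartialCone (x + 1) (Finset.Icc 1 (3 * C) ∪ N) T' 0 ∧
      (∀ c < C, HasLeg T' (x + 1) c) ∧ P ⊆ T') ∧
    ∀ i, N.card ≤ i + 2 → i + 2 ≤ N.card + 3 * C →
      HasSandwich (x + 2) ((x - 1).choose 2 + i) := by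
  have hout : ∀ {M : Finset ℕ} {S : Finset (Finset ℕ)} {σ i : ℕ}, PartialCone (x + 1) M S σ →
      σ ≤ 2 → M.card = i + 2 → HasSandwich (x + 2) ((x - 1).choose 2 + i) := by
    intro M S σ i hM hσ hi
    have := hM.hasSandwich hσ (by omega)
    rwa [hi, Nat.add_sub_cancel] at this
  have hcardk : ∀ k ≤ C, (Finset.Icc 1 (3 * k) ∪ N).card = 3 * k + N.card := by
    intro k hk
    rw [Finset.card_union_of_disjoint, Nat.card_Icc]
    · omega
    · rw [Finset.disjoint_left]
      intro y hy hyN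
      have := Finset.mem_Icc.1 hy
      have := hN y hyN
      omega
  have main : ∀ k ≤ C, (∃ T', PartialCone (x + 1) (Finset.Icc 1 (3 * k) ∪ N) T' 0 ∧
      (∀ c, k ≤ c → c < C → HasLeg T' x c) ∧ (∀ c < k, HasLeg T' (x + 1) c) ∧ P ⊆ T') ∧
      ∀ i, N.card ≤ i + 2 → i + 2 ≤ N.card + 3 * k →
        HasSandwich (x + 2) ((x - 1).choose 2 + i) := by
    intro k
    induction k with
    | zero =>
      refine fun _ => ⟨⟨T, ?_, fun c _ => hlegs c, fun c hc => absurd hc c.not_lt_zero, hPT⟩,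
        fun i h1 h2 => hout h (by omega) (by omega)⟩
      simpa using h
    | succ k ih =>
      intro hk
      obtain ⟨⟨T', hT', hold, hnew, hPT'⟩, hsand⟩ := ih (by omega)
      have hck := hcardk k (by omega)
      have hck' := hcardk (k + 1) hk
      have hNk : ∀ y ∈ Finset.Icc 1 (3 * k) ∪ N, y ≤ 3 * k ∨ 3 * k + 3 < y := by
        intro y hy
        obtain hy | hy := Finset.mem_union.1 hy
        · exact Or.inl (Finset.mem_Icc.1 hy).2
        · have := hN y hy
          omega
      obtain ⟨⟨T'', hT'', hold', hnew', hPT''⟩, ⟨N₁, T₁, σ₁, hN₁, hσ₁, h₁⟩,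
        ⟨N₂, T₂, σ₂, hN₂, hσ₂, h₂⟩⟩ := hT'.extend_leg (Finset.mem_union_right _ hw) hC hNk hold hk
          hnew hPT' (fun t ht => by
            obtain ⟨y, hy, h1, h2⟩ := hP t ht
            exact ⟨y, hy, by omega, h2⟩) hpath
      have hset : insert (3 * k + 1) (insert (3 * k + 2) (insert (3 * k + 3)
          (Finset.Icc 1 (3 * k) ∪ N))) = Finset.Icc 1 (3 * (k + 1)) ∪ N := by
        ext y
        simp only [Finset.mem_insert, Finset.mem_union, Finset.mem_Icc]
        by_cases hy : y ∈ N <;> simp only [hy, or_true, or_false]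
        omega
      rw [hset] at hT''
      refine ⟨⟨T'', hT'', hold', hnew', hPT''⟩, fun i h1 h2 => ?_⟩
      obtain h3 | h3 | h3 | h3 : i + 2 ≤ N.card + 3 * k ∨ i + 2 = N.card + 3 * k + 1 ∨
        i + 2 = N.card + 3 * k + 2 ∨ i + 2 = N.card + 3 * k + 3 := by omega
      · exact hsand i h1 h3
      · exact hout h₁ hσ₁ (by omega)
      · exact hout h₂ hσ₂ (by omega)
      · exact hout hT'' (by omega) (by omega)
  obtain ⟨⟨T', hT', -, hnew, hPT'⟩, hsand⟩ := main C le_rfl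
  exact ⟨⟨T', hT', hnew, hPT'⟩, hsand⟩

end Legs

section Stages

open Relation

variable {T : Finset (Finset ℕ)}

theorem completeEdges_three : CompleteEdges 3 {{1, 2, 3}} 0 := by
  have hset : ({1, 2, 3} : Finset ℕ) = Finset.Icc 1 3 := by decide
  have hedges : edgesOf {({1, 2, 3} : Finset ℕ)} = Finset.powersetCard 2 (Finset.Icc 1 3) := by
    rw [hset, edgesOf, Finset.singleton_biUnion]
  have hmem : ∀ u v, {u, v} ∈ edgesOf {({1, 2, 3} : Finset ℕ)} →
      u ∈ Finset.Icc 1 3 ∧ v ∈ Finset.Icc 1 3 := by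
    intro u v h
    rw [hedges] at h
    have hs := (Finset.mem_powersetCard.1 h).1
    exact ⟨hs (by simp), hs (by simp)⟩
  refine ⟨⟨by omega, ?_, ?_, ?_, ?_⟩, hedges, rfl⟩
  · simp
  · simp [hset]
  · intro x a b ha hb
    have hxa := ne_of_pair_mem_edgesOf ha
    have hxb := ne_of_pair_mem_edgesOf hb
    obtain ⟨hx, ha⟩ := hmem x a ha
    obtain ⟨-, hb⟩ := hmem x b hb
    by_cases hab : a = b
    · exact hab ▸ ReflTransGen.refl
    · refine LinkPath.single (Finset.mem_singleton.2 ?_)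
      rw [hset]
      refine Finset.eq_of_subset_of_card_le ?_ ?_
      · exact Finset.insert_subset hx
          (Finset.insert_subset ha (Finset.singleton_subset_iff.2 hb))
      · rw [Finset.card_eq_three.2 ⟨x, a, b, hxa, hxb, hab, rfl⟩]
        simp
  · intro u hu v hv
    by_cases huv : u = v
    · exact huv ▸ ReflTransGen.refl
    · refine ReflTransGen.single ?_
      rw [hedges]
      exact pair_mem_powersetCard_Icc hu hv huv

theorem hasSandwich_three : HasSandwich 3 0 := by
  have h := completeEdges_three
  have hE : (edgesOf {({1, 2, 3} : Finset ℕ)}).card = 3 := by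
    rw [h.edges]
    rfl
  refine ⟨_, _, h.wellLinked, Finset.Subset.refl _, h.wellLinked.card_eq, Finset.Subset.refl _,
    ?_, ?_, ?_⟩
  · rw [hE]
  · rw [hE]
    simp
  · simp [macaulay2]

theorem CompleteEdges.step_of_mod_zero {C : ℕ} (h : CompleteEdges (3 * C + 3) T 0)
    (hlegs : ∀ c < C, HasLeg T (3 * C + 2) c) (ht : {3 * C + 1, 3 * C + 2, 3 * C + 3} ∈ T) :
    (∃ T', CompleteEdges (3 * C + 4) T' 1 ∧ (∀ c < C, HasLeg T' (3 * C + 3) c) ∧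
      {3 * C + 1, 3 * C + 2, 3 * C + 3} ∈ T' ∧ {3 * C + 4, 3 * C + 3, 3 * C + 2} ∈ T' ∧
      {3 * C + 3, 3 * C + 4, 3 * C + 1} ∈ T') ∧
    ∀ i ≤ 3 * C + 1, HasSandwich (3 * C + 4) ((3 * C + 1).choose 2 + i) := by
  have h1 := h.cone (u := 3 * C + 3) (v := 3 * C + 2) (Finset.mem_Icc.2 (by omega))
    (Finset.mem_Icc.2 (by omega)) (by omega)
  have hcard : ({3 * C + 3, 3 * C + 2} : Finset ℕ).card = 2 := Finset.card_pair (by omega)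
  obtain ⟨⟨T₁, h2, hlegs', hP⟩, hsand⟩ := PartialCone.extend_legs (x := 3 * C + 2) (C := C)
    (P := {{3 * C + 4, 3 * C + 3, 3 * C + 2}, {3 * C + 1, 3 * C + 2, 3 * C + 3}})
    h1 (by simp) (by omega) (by simp) (fun c hc => (hlegs c hc).mono (Finset.subset_insert _ _))
    (by
      intro t htP
      simp only [Finset.mem_insert, Finset.mem_singleton] at htP
      obtain rfl | rfl := htP
      · exact Finset.mem_insert_self _ _
      · exact Finset.mem_insert_of_mem ht)
    (by
      intro t htP
      refine ⟨3 * C + 2, ?_, by omega, by omega⟩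
      simp only [Finset.mem_insert, Finset.mem_singleton] at htP
      obtain rfl | rfl := htP <;> simp)
    (LinkPath.single (by
      rw [Finset.mem_insert]
      left
      rw [triple_rotate, triple_rotate]))
  have hN : 3 * C + 1 ∉ Finset.Icc 1 (3 * C) ∪ {3 * C + 3, 3 * C + 2} := by simp
  have h3 := h2.insert_neighbor (u := 3 * C + 3) (v := 3 * C + 1) (by simp)
    (Finset.mem_Icc.2 (by omega)) hN
  have hset : insert (3 * C + 1) (Finset.Icc 1 (3 * C) ∪ {3 * C + 3, 3 * C + 2}) =
      Finset.Icc 1 (3 * C + 2 + 1) := by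
    ext y
    simp only [Finset.mem_insert, Finset.mem_union, Finset.mem_Icc, Finset.mem_singleton]
    omega
  rw [hset] at h3
  refine ⟨⟨_, h3.complete, fun c hc => (hlegs' c hc).mono (Finset.subset_insert _ _),
    Finset.mem_insert_of_mem (hP (by simp)), Finset.mem_insert_of_mem (hP (by simp)),
    Finset.mem_insert_self _ _⟩, fun i hi => ?_⟩
  rw [hcard] at hsand
  by_cases hi' : i ≤ 3 * C
  · exact hsand i (by omega) (by omega)
  · obtain rfl : i = 3 * C + 1 := by omega
    have := h3.hasSandwich (by omega) (by rw [Nat.card_Icc]; omega)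
    rwa [Nat.card_Icc] at this

theorem CompleteEdges.step_of_mod_one {C : ℕ} (h : CompleteEdges (3 * C + 4) T 1)
    (hlegs : ∀ c < C, HasLeg T (3 * C + 3) c) (h123 : {3 * C + 1, 3 * C + 2, 3 * C + 3} ∈ T)
    (h432 : {3 * C + 4, 3 * C + 3, 3 * C + 2} ∈ T)
    (h341 : {3 * C + 3, 3 * C + 4, 3 * C + 1} ∈ T) :
    (∃ T', CompleteEdges (3 * C + 5) T' 0 ∧ ∀ c < C + 1, HasLeg T' (3 * C + 4) c) ∧
    ∀ i ≤ 3 * C + 2, HasSandwich (3 * C + 5) ((3 * C + 2).choose 2 + i) := by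
  have h1 := h.cone (u := 3 * C + 4) (v := 3 * C + 2) (Finset.mem_Icc.2 (by omega))
    (Finset.mem_Icc.2 (by omega)) (by omega)
  have hcard : ({3 * C + 4, 3 * C + 2} : Finset ℕ).card = 2 := Finset.card_pair (by omega)
  have hn2 : 3 * C + 1 ∉ ({3 * C + 4, 3 * C + 2} : Finset ℕ) := by simp
  have h2 := h1.insert_neighbor (u := 3 * C + 2) (v := 3 * C + 1) (by simp)
    (Finset.mem_Icc.2 (by omega)) hn2
  have hn3 : 3 * C + 3 ∉ insert (3 * C + 1) ({3 * C + 4, 3 * C + 2} : Finset ℕ) := by simp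
  have h3 := h2.insert_neighbor (u := 3 * C + 1) (v := 3 * C + 3) (by simp)
    (Finset.mem_Icc.2 (by omega)) hn3
  have hs0 := h1.hasSandwich (by omega) (by omega)
  have hs1 := h2.hasSandwich (by omega) (by rw [Finset.card_insert_of_notMem hn2]; omega)
  rw [hcard] at hs0
  rw [Finset.card_insert_of_notMem hn2, hcard] at hs1
  set U := insert {3 * C + 1, 3 * C + 4 + 1, 3 * C + 3} (insert
    {3 * C + 2, 3 * C + 4 + 1, 3 * C + 1} (insert {3 * C + 4 + 1, 3 * C + 4, 3 * C + 2} T)) with hU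
  have hTU : T ⊆ U := by
    intro t ht
    simp [hU, ht]
  set R : Finset ℕ := {3 * C + 1, 3 * C + 2, 3 * C + 3} with hR
  have h4R : 3 * C + 4 ∉ R := by simp [hR]
  have h5R : 3 * C + 5 ∉ R := by simp [hR]
  have m1 : ({3 * C + 5, 3 * C + 4, 3 * C + 2} : Finset ℕ) ∈ U.erase R :=
    mem_erase_of_notMem (a := 3 * C + 5) (by simp [hU]) (by simp) h5R
  have m2 : ({3 * C + 5, 3 * C + 2, 3 * C + 1} : Finset ℕ) ∈ U.erase R := by
    rw [triple_swap]
    exact mem_erase_of_notMem (a := 3 * C + 5) (by simp [hU]) (by simp) h5R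
  have m3 : ({3 * C + 5, 3 * C + 1, 3 * C + 3} : Finset ℕ) ∈ U.erase R := by
    rw [triple_swap]
    exact mem_erase_of_notMem (a := 3 * C + 5) (by simp [hU]) (by simp) h5R
  have m4 : ({3 * C + 4, 3 * C + 3, 3 * C + 2} : Finset ℕ) ∈ U.erase R :=
    mem_erase_of_notMem (hTU h432) (a := 3 * C + 4) (by simp) h4R
  have m5 : ({3 * C + 3, 3 * C + 4, 3 * C + 1} : Finset ℕ) ∈ U.erase R :=
    mem_erase_of_notMem (hTU h341) (a := 3 * C + 4) (by simp) h4R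
  have p1 : LinkPath (U.erase R) (3 * C + 1) (3 * C + 2) (3 * C + 3) := by
    refine (LinkPath.single (b := 3 * C + 5) ?_).trans (LinkPath.single ?_)
    · rwa [triple_rotate, triple_swap] at m2
    · rwa [triple_swap]
  have p2 : LinkPath (U.erase R) (3 * C + 2) (3 * C + 1) (3 * C + 3) := by
    refine (LinkPath.single (b := 3 * C + 5) ?_).trans ((LinkPath.single (b := 3 * C + 4) ?_).trans
      (LinkPath.single ?_))
    · rwa [triple_rotate] at m2
    · rwa [triple_rotate]
    · rwa [triple_rotate]
  have p3 : LinkPath (U.erase R) (3 * C + 3) (3 * C + 1) (3 * C + 2) := by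
    refine (LinkPath.single (b := 3 * C + 4) ?_).trans (LinkPath.single ?_)
    · rwa [Finset.pair_comm]
    · rwa [triple_swap]
  have h4 := h3.erase_triangle (σ := 0) (hTU h123) p1 p2 p3
  obtain ⟨⟨T₁, h5, hlegs', hP⟩, hsand⟩ := PartialCone.extend_legs (x := 3 * C + 3) (C := C)
    (P := {{3 * C + 5, 3 * C + 4, 3 * C + 2}, {3 * C + 5, 3 * C + 2, 3 * C + 1},
      {3 * C + 5, 3 * C + 1, 3 * C + 3}, {3 * C + 4, 3 * C + 3, 3 * C + 2}})
    h4 (by simp) (by omega) (by simp) (fun c hc => ((hlegs c hc).mono hTU).erase h4R)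
    (by
      intro t ht
      simp only [Finset.mem_insert, Finset.mem_singleton] at ht
      obtain rfl | rfl | rfl | rfl := ht <;> assumption)
    (by
      intro t ht
      simp only [Finset.mem_insert, Finset.mem_singleton] at ht
      obtain rfl | rfl | rfl | rfl := ht
      · exact ⟨3 * C + 5, by simp, by omega, by omega⟩
      · exact ⟨3 * C + 5, by simp, by omega, by omega⟩
      · exact ⟨3 * C + 5, by simp, by omega, by omega⟩
      · exact ⟨3 * C + 3, by simp, by omega, by omega⟩)
    ((LinkPath.single (b := 3 * C + 2) (by simp)).trans
      (LinkPath.single (by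
        rw [triple_rotate, triple_rotate]
        simp)))
  have hset : Finset.Icc 1 (3 * C) ∪ insert (3 * C + 3) (insert (3 * C + 1)
      {3 * C + 4, 3 * C + 2}) = Finset.Icc 1 (3 * C + 3 + 1) := by
    ext y
    simp only [Finset.mem_insert, Finset.mem_union, Finset.mem_Icc, Finset.mem_singleton]
    omega
  rw [hset] at h5
  rw [Finset.card_insert_of_notMem hn3, Finset.card_insert_of_notMem hn2, hcard] at hsand
  refine ⟨⟨T₁, h5.complete, fun c hc => ?_⟩, fun i hi => ?_⟩
  · obtain hc | rfl := Nat.lt_succ_iff_lt_or_eq.1 hc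
    · exact hlegs' c hc
    · have e1 : near (3 * c + 4 + 1) c = 3 * c + 2 := if_pos (by omega)
      have e2 : near (3 * c + 4 + 2) c = 3 * c + 3 := if_neg (by omega)
      rw [HasLeg, e1, e2]
      exact ⟨hP (by simp), hP (by simp), hP (by simp)⟩
  · obtain rfl | rfl | hi' : i = 0 ∨ i = 1 ∨ 2 ≤ i := by omega
    · exact hs0
    · exact hs1
    · exact hsand i (by omega) (by omega)

theorem CompleteEdges.step_of_mod_two {C : ℕ} (h : CompleteEdges (3 * C + 2) T 0)
    (hlegs : ∀ c < C, HasLeg T (3 * C + 1) c) :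
    (∃ T', CompleteEdges (3 * C + 3) T' 0 ∧ (∀ c < C, HasLeg T' (3 * C + 2) c) ∧
      {3 * C + 1, 3 * C + 2, 3 * C + 3} ∈ T') ∧
    ∀ i ≤ 3 * C, HasSandwich (3 * C + 3) ((3 * C).choose 2 + i) := by
  have h1 := h.cone (u := 3 * C + 2) (v := 3 * C + 1) (Finset.mem_Icc.2 (by omega))
    (Finset.mem_Icc.2 (by omega)) (by omega)
  have hcard : ({3 * C + 2, 3 * C + 1} : Finset ℕ).card = 2 := Finset.card_pair (by omega)
  have htriple : ({3 * C + 2 + 1, 3 * C + 2, 3 * C + 1} : Finset ℕ) =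
      {3 * C + 1, 3 * C + 2, 3 * C + 3} := by
    ext
    simp
    tauto
  obtain ⟨⟨T₁, h2, hlegs', hP⟩, hsand⟩ := PartialCone.extend_legs (x := 3 * C + 1) (C := C)
    (P := {{3 * C + 1, 3 * C + 2, 3 * C + 3}})
    h1 (by simp) (by omega) (by simp) (fun c hc => (hlegs c hc).mono (Finset.subset_insert _ _))
    (by simp [htriple])
    (by
      intro t ht
      rw [Finset.mem_singleton] at ht
      exact ⟨3 * C + 1, by simp [ht], by omega, by omega⟩)
    (LinkPath.single (by rw [triple_swap]; simp))
  have hset : Finset.Icc 1 (3 * C) ∪ {3 * C + 2, 3 * C + 1} = Finset.Icc 1 (3 * C + 1 + 1) := by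
    ext y
    simp only [Finset.mem_insert, Finset.mem_union, Finset.mem_Icc, Finset.mem_singleton]
    omega
  rw [hset] at h2
  rw [hcard] at hsand
  exact ⟨⟨T₁, h2.complete, hlegs', hP (by simp)⟩, fun i hi => hsand i (by omega) (by omega)⟩

theorem exists_completeEdges (C : ℕ) :
    ∃ T, CompleteEdges (3 * C + 3) T 0 ∧ (∀ c < C, HasLeg T (3 * C + 2) c) ∧
      {3 * C + 1, 3 * C + 2, 3 * C + 3} ∈ T := by
  induction C with
  | zero =>
    exact ⟨_, completeEdges_three, fun c hc => absurd hc c.not_lt_zero, by simp⟩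
  | succ C ih =>
    obtain ⟨T, hT, hlegs, ht⟩ := ih
    obtain ⟨⟨T₁, hT₁, hlegs₁, h123, h432, h341⟩, -⟩ := hT.step_of_mod_zero hlegs ht
    obtain ⟨⟨T₂, hT₂, hlegs₂⟩, -⟩ := hT₁.step_of_mod_one hlegs₁ h123 h432 h341
    exact (CompleteEdges.step_of_mod_two (C := C + 1) hT₂ hlegs₂).1

theorem hasSandwich_choose_two_add {b i : ℕ} (hb : 1 ≤ b) (hi : i ≤ b) :
    HasSandwich (b + 3) (b.choose 2 + i) := by
  obtain ⟨C, hC⟩ : ∃ C, b = 3 * C + 1 ∨ b = 3 * C + 2 ∨ b = 3 * C + 3 := ⟨(b - 1) / 3, by omega⟩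
  obtain ⟨T, hT, hlegs, ht⟩ := exists_completeEdges C
  obtain ⟨⟨T₁, hT₁, hlegs₁, h123, h432, h341⟩, hs₁⟩ := hT.step_of_mod_zero hlegs ht
  obtain ⟨⟨T₂, hT₂, hlegs₂⟩, hs₂⟩ := hT₁.step_of_mod_one hlegs₁ h123 h432 h341
  obtain rfl | rfl | rfl := hC
  · exact hs₁ i hi
  · exact hs₂ i hi
  · exact (CompleteEdges.step_of_mod_two (C := C + 1) hT₂ hlegs₂).2 i hi

theorem hasSandwich_of_le {m a : ℕ} (h : a ≤ (m + 1).choose 2) : HasSandwich (m + 3) a := by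
  obtain rfl | ha := Nat.eq_zero_or_pos a
  · exact hasSandwich_three.mono (by omega)
  obtain ⟨b, r, hr, rfl⟩ := exists_eq_choose_two_add a
  by_cases hbm : b ≤ m
  · obtain rfl | hb := Nat.eq_zero_or_pos b
    · simp only [Nat.choose_zero_succ] at ha
      omega
    · exact (hasSandwich_choose_two_add hb hr).mono (by omega)
  · have hle : (m + 1).choose 2 ≤ b.choose 2 := Nat.choose_le_choose 2 (by omega)
    have heq : b.choose 2 + r = m.choose 2 + m := by
      have := succ_choose_two m
      omega
    rw [heq] at ha ⊢
    refine hasSandwich_choose_two_add ?_ le_rfl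
    by_contra hm
    obtain rfl : m = 0 := by omega
    simp at ha

theorem exists_isBuchsbaum_of_hVector3_bounds (K : Type) [Field K] {h1 h2 h3 : ℤ} (H1 : 0 ≤ h1) (H2 : 0 ≤ h2)
    (H3 : h2 ≤ (((h1 + 1).toNat.choose 2 : ℕ) : ℤ)) (H4 : -h2 ≤ 3 * h3)
    (H5 : h3 ≤ ((macaulay2 h2.toNat : ℕ) : ℤ)) :
    ∃ (n : ℕ) (Δ : Finset (Finset ℕ)), IsComplexOn n Δ ∧ dimZ Δ = 2 ∧
        IsConnectedComplex Δ ∧ IsBuchsbaum K Δ ∧ hVector3 Δ 1 h1 h2 h3 := by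
  obtain ⟨m, rfl⟩ := Int.eq_ofNat_of_zero_le H1
  obtain ⟨a, rfl⟩ := Int.eq_ofNat_of_zero_le H2
  rw [show ((m : ℤ) + 1).toNat = m + 1 by omega] at H3
  rw [Int.toNat_natCast] at H5
  obtain ⟨T, H, hT, hTH, hH, hedges, hE, hcard, hHcard⟩ :=
    hasSandwich_of_le (m := m) (a := a) (by exact_mod_cast H3)
  obtain ⟨k, hk⟩ : ∃ k : ℕ, (k : ℤ) = m + 1 + a + h3 := ⟨(m + 1 + a + h3).toNat, by omega⟩
  obtain ⟨S, hTS, hSH, hS⟩ := Finset.exists_subsuperset_card_eq hTH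
    (show T.card ≤ k by omega) (show k ≤ H.card by omega)
  have hSedges : edgesOf S = edgesOf T :=
    ((edgesOf_mono hSH).trans hedges).antisymm (edgesOf_mono hTS)
  have hWL := hT.of_subset hTS (fun t ht => hH t (hSH ht)) hSedges.le
  refine ⟨m + 3, generatedBy S, hWL.isComplexOn, hWL.dimZ_eq, hWL.isConnectedComplex,
    hWL.isBuchsbaum K, (hVector3_iff hWL.isComplexOn _ _ _).2 ⟨?_, ?_, ?_⟩⟩
  · push_cast
    ring
  · rw [facesOf_two_generatedBy, hSedges]
    omega
  · rw [facesOf_two_generatedBy, facesOf_three_generatedBy hWL.card_eq, hSedges]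
    omega

end Stages
/-- **Theorem 1.1.** `(1,h1,h2,h3)` is the `h`-vector of a `2`-dimensional connected
Buchsbaum complex iff `0 ≤ h1`, `0 ≤ h2 ≤ C(h1+1,2)` and `-(1/3)h2 ≤ h3 ≤ h2^⟨2⟩`. -/
theorem stmt0 (K : Type) [Field K] (h1 h2 h3 : ℤ) :
    (∃ (n : ℕ) (Δ : Finset (Finset ℕ)), IsComplexOn n Δ ∧ dimZ Δ = 2 ∧
        IsConnectedComplex Δ ∧ IsBuchsbaum K Δ ∧ hVector3 Δ 1 h1 h2 h3) ↔
      (0 ≤ h1 ∧ 0 ≤ h2 ∧ h2 ≤ (((h1 + 1).toNat.choose 2 : ℕ) : ℤ) ∧ -h2 ≤ 3 * h3 ∧ h3 ≤ ((macaulay2 h2.toNat : ℕ) : ℤ)) := by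
  constructor
  · rintro ⟨n, Δ, hΔ, hdim, hconn, hB, hvec⟩
    exact hVector3_bounds_of_isBuchsbaum K hΔ hdim hconn hB hvec
  · rintro ⟨H1, H2, H3, H4, H5⟩
    exact exists_isBuchsbaum_of_hVector3_bounds K H1 H2 H3 H4 H5
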